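/- arXiv:2212.04303 — 8 statements merged into one kernel-verified Lean document; each statement's English description precedes it below -/
import Mathlib

section
/- Let σ be a minimal continuous flow on a nonempty compact metric space Ω and let a : Ω → ℝ be continuous. Set γ^i := inf { ∫_Ω a dm : m a σ-invariant Borel probability measure } and γ^s := sup { ∫_Ω a dm : m a σ-invariant Borel probability measure }. Then for every λ ∈ ℝ, the family x' = (a(ω·t) − λ)x fails to have exponential dichotomy over Ω if and only if γ^i ≤ λ ≤ γ^s; that is, the Sacker–Sell spectrum Σ_a equals the interval [γ^i, γ^s]. -/
open MeasureTheory

/-- The family `x' = c(ω·t)x` has exponential dichotomy over `Ω`. -/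
def ExpDichotomy {Ω : Type*} (σ : ℝ → Ω → Ω) (c : Ω → ℝ) : Prop :=
  ∃ κ ≥ (1:ℝ), ∃ γ > (0:ℝ),
    (∀ ω : Ω, ∀ t ≥ (0:ℝ),
        Real.exp (∫ s in (0:ℝ)..t, c (σ s ω)) ≤ κ * Real.exp (-γ * t)) ∨
    (∀ ω : Ω, ∀ t ≤ (0:ℝ),
        Real.exp (∫ s in (0:ℝ)..t, c (σ s ω)) ≤ κ * Real.exp (γ * t))

open Filter Topology

section Flow

variable {Ω : Type*} [MetricSpace Ω]
  {σ : ℝ → Ω → Ω}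

lemma Continuous.intervalIntegrable_comp_flow (hσ : Continuous fun p : ℝ × Ω => σ p.1 p.2)
    {f : Ω → ℝ} (hf : Continuous f) (ω : Ω) (s t : ℝ) :
    IntervalIntegrable (fun u => f (σ u ω)) volume s t :=
  Continuous.intervalIntegrable
    (hf.comp (hσ.comp (continuous_id.prodMk continuous_const))) s t

variable [MeasurableSpace Ω] [BorelSpace Ω]

/-- The uniform distribution on the orbit segment `{σ s ω : 0 < s ≤ T}`. -/
noncomputable def occupationMeasure (σ : ℝ → Ω → Ω) (T : ℝ) (ω : Ω) : Measure Ω :=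
  (ProbabilityTheory.cond volume (Set.Ioc 0 T)).map fun s => σ s ω

lemma isProbabilityMeasure_occupationMeasure (hσ : Continuous fun p : ℝ × Ω => σ p.1 p.2)
    {T : ℝ} (hT : 0 < T) (ω : Ω) : IsProbabilityMeasure (occupationMeasure σ T ω) := by
  have : IsProbabilityMeasure (ProbabilityTheory.cond volume (Set.Ioc 0 T)) :=
    ProbabilityTheory.cond_isProbabilityMeasure_of_finite (by simpa using hT) (by simp)
  have h : Continuous fun s => σ s ω := hσ.comp (continuous_id.prodMk continuous_const)
  exact Measure.isProbabilityMeasure_map h.aemeasurable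

lemma integral_occupationMeasure (hσ : Continuous fun p : ℝ × Ω => σ p.1 p.2)
    {T : ℝ} (hT : 0 < T) (ω : Ω) {f : Ω → ℝ} (hf : Continuous f) :
    ∫ x, f x ∂(occupationMeasure σ T ω) = T⁻¹ * ∫ s in (0:ℝ)..T, f (σ s ω) := by
  have h : Continuous fun s => σ s ω := hσ.comp (continuous_id.prodMk continuous_const)
  rw [occupationMeasure, integral_map h.aemeasurable hf.aestronglyMeasurable,
    ProbabilityTheory.cond, integral_smul_measure, intervalIntegral.integral_of_le hT.le]
  simp [hT.le]

variable [CompactSpace Ω]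

/-- Krylov–Bogoliubov: limits of the uniform distributions on longer and longer orbit segments
are invariant. -/
lemma exists_invariant_measure_tendsto (hσ : Continuous fun p : ℝ × Ω => σ p.1 p.2)
    (hadd : ∀ s t ω, σ (s + t) ω = σ s (σ t ω)) (w : ℕ → Ω) :
    ∃ m : Measure Ω, IsProbabilityMeasure m ∧ (∀ t, Measure.map (σ t) m = m) ∧
      ∃ U : Ultrafilter ℕ, ∀ f : Ω → ℝ, Continuous f →
        Tendsto (fun n : ℕ => ((n:ℝ) + 1)⁻¹ * ∫ s in (0:ℝ)..(n + 1), f (σ s (w n)))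
          U (𝓝 (∫ x, f x ∂m)) := by
  let μ : ℕ → ProbabilityMeasure Ω := fun n =>
    ⟨occupationMeasure σ (n + 1) (w n), isProbabilityMeasure_occupationMeasure hσ (by positivity) _⟩
  let U : Ultrafilter ℕ := hyperfilter ℕ
  have hU : (U : Filter ℕ) ≤ atTop := by
    rw [← Nat.cofinite_eq_atTop]; exact hyperfilter_le_cofinite
  obtain ⟨m, -, hm⟩ := isCompact_univ.ultrafilter_le_nhds (U.map μ) (by simp)
  have hlim : ∀ f : Ω → ℝ, Continuous f →
      Tendsto (fun n : ℕ => ((n:ℝ) + 1)⁻¹ * ∫ s in (0:ℝ)..(n + 1), f (σ s (w n)))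
        U (𝓝 (∫ x, f x ∂(m : Measure Ω))) := by
    intro f hf
    have := (ProbabilityMeasure.tendsto_iff_forall_integral_tendsto (μs := μ)).1 hm
      (BoundedContinuousFunction.mkOfCompact ⟨f, hf⟩)
    refine this.congr fun n => ?_
    exact integral_occupationMeasure hσ (by positivity) _ hf
  refine ⟨m, inferInstance, fun t => ?_, U, hlim⟩
  have hσt : Continuous (σ t) := hσ.comp (continuous_const.prodMk continuous_id)
  have : IsProbabilityMeasure (Measure.map (σ t) (m : Measure Ω)) :=
    Measure.isProbabilityMeasure_map hσt.aemeasurable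
  refine ext_of_forall_integral_eq_of_IsFiniteMeasure fun f => ?_
  rw [integral_map hσt.aemeasurable f.continuous.aestronglyMeasurable]
  have hsub := (hlim _ (f.continuous.comp hσt)).sub (hlim _ f.continuous)
  refine sub_eq_zero.1 (tendsto_nhds_unique hsub ?_)
  have hzero : Tendsto (fun n : ℕ => 2 * ‖f‖ * |t| * ((n:ℝ) + 1)⁻¹) U (𝓝 0) := by
    have := (tendsto_one_div_add_atTop_nhds_zero_nat (𝕜 := ℝ)).const_mul (2 * ‖f‖ * |t|)
    simpa using this.mono_left hU
  refine squeeze_zero_norm (fun n => ?_) hzero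
  have hi := Continuous.intervalIntegrable_comp_flow hσ f.continuous (w n)
  have hshift : ∫ s in (0:ℝ)..(n + 1), (f ∘ σ t) (σ s (w n))
      = ∫ s in (0 + t)..(n + 1 + t), f (σ s (w n)) := by
    rw [← intervalIntegral.integral_comp_add_right (fun s => f (σ s (w n)))]
    simp only [Function.comp, ← hadd, add_comm t]
  have hbound : ∀ u : ℝ, ‖∫ s in u..(u + t), f (σ s (w n))‖ ≤ ‖f‖ * |t| := fun u => by
    simpa using intervalIntegral.norm_integral_le_of_norm_le_const (a := u) (b := u + t)
      (f := fun s => f (σ s (w n))) (C := ‖f‖) (fun s _ => f.norm_coe_le_norm _)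
  have hsplit : (∫ s in (0 + t)..(n + 1 + t), f (σ s (w n))) - ∫ s in (0:ℝ)..(n + 1), f (σ s (w n))
      = (∫ s in ((n:ℝ) + 1)..(n + 1 + t), f (σ s (w n))) - ∫ s in (0:ℝ)..(0 + t), f (σ s (w n)) := by
    rw [← intervalIntegral.integral_add_adjacent_intervals (hi (0 + t) 0) (hi 0 (n + 1 + t)),
      ← intervalIntegral.integral_add_adjacent_intervals (hi 0 (n + 1)) (hi (n + 1) (n + 1 + t)),
      intervalIntegral.integral_symm 0 (0 + t)]
    ring
  rw [hshift, ← mul_sub, hsplit, norm_mul, Real.norm_of_nonneg (by positivity), mul_comm]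
  gcongr
  linarith [norm_sub_le (∫ s in ((n:ℝ) + 1)..(n + 1 + t), f (σ s (w n)))
    (∫ s in (0:ℝ)..(0 + t), f (σ s (w n))), hbound (n + 1), hbound 0]

lemma integral_le_neg_of_exp_le (hσ : Continuous fun p : ℝ × Ω => σ p.1 p.2)
    {c : Ω → ℝ} (hc : Continuous c) {κ γ : ℝ} (hκ : 1 ≤ κ)
    (h : ∀ ω : Ω, ∀ t ≥ (0:ℝ),
      Real.exp (∫ s in (0:ℝ)..t, c (σ s ω)) ≤ κ * Real.exp (-γ * t))
    (m : Measure Ω) [IsProbabilityMeasure m] (hm : ∀ t, Measure.map (σ t) m = m) :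
    ∫ x, c x ∂m ≤ -γ := by
  have hlog : ∀ ω : Ω, ∀ t ≥ (0:ℝ), ∫ s in (0:ℝ)..t, c (σ s ω) ≤ Real.log κ - γ * t := by
    intro ω t ht
    have := Real.log_le_log (Real.exp_pos _) (h ω t ht)
    rw [Real.log_mul (by positivity) (Real.exp_pos _).ne', Real.log_exp, Real.log_exp] at this
    linarith
  have hσs : ∀ s, Continuous (σ s) := fun s => hσ.comp (continuous_const.prodMk continuous_id)
  obtain ⟨M, hM⟩ := (isCompact_range hc.norm).bddAbove
  have hswap : ∀ t ≥ (0:ℝ), ∫ ω, (∫ s in (0:ℝ)..t, c (σ s ω)) ∂m = t * ∫ x, c x ∂m ∧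
      Integrable (fun ω => ∫ s in (0:ℝ)..t, c (σ s ω)) m := by
    intro t ht
    have hint : Integrable (Function.uncurry fun (ω : Ω) (s : ℝ) => c (σ s ω))
        (m.prod (volume.restrict (Set.Ioc 0 t))) := by
      refine Integrable.of_bound (C := M) ?_ (ae_of_all _ fun p => hM ⟨_, rfl⟩)
      exact (hc.comp (hσ.comp continuous_swap)).aestronglyMeasurable
    simp only [intervalIntegral.integral_of_le ht]
    refine ⟨?_, hint.integral_prod_left⟩
    rw [integral_integral_swap hint]
    have hinv : ∀ s, ∫ x, c (σ s x) ∂m = ∫ x, c x ∂m := fun s => by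
      rw [← integral_map (hσs s).aemeasurable hc.aestronglyMeasurable, hm s]
    simp [hinv, ht]
  have key : ∀ t ≥ (0:ℝ), t * ∫ x, c x ∂m ≤ Real.log κ - γ * t := by
    intro t ht
    rw [← (hswap t ht).1]
    simpa using integral_mono (hswap t ht).2 (integrable_const _) fun ω => hlog ω t ht
  by_contra! hlt
  set d := ∫ x, c x ∂m + γ with hd
  have hdpos : 0 < d := by linarith
  have h0 := Real.log_nonneg hκ
  have := key ((Real.log κ + 1) / d) (by positivity)
  have e : (Real.log κ + 1) / d * d = Real.log κ + 1 := by field_simp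
  nlinarith

lemma exists_exp_le_of_integral_le (hσ : Continuous fun p : ℝ × Ω => σ p.1 p.2)
    (hadd : ∀ s t ω, σ (s + t) ω = σ s (σ t ω)) {c : Ω → ℝ} (hc : Continuous c)
    {δ : ℝ} (hδ : 0 < δ)
    (h : ∀ m : Measure Ω, IsProbabilityMeasure m → (∀ t, Measure.map (σ t) m = m) →
      ∫ x, c x ∂m ≤ -δ) :
    ∃ κ ≥ (1:ℝ), ∃ γ > (0:ℝ), ∀ ω : Ω, ∀ t ≥ (0:ℝ),
      Real.exp (∫ s in (0:ℝ)..t, c (σ s ω)) ≤ κ * Real.exp (-γ * t) := by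
  have hi := Continuous.intervalIntegrable_comp_flow hσ hc
  obtain ⟨T, hT, hneg⟩ : ∃ T > (0:ℝ), ∀ ω, ∫ s in (0:ℝ)..T, c (σ s ω) ≤ -(δ / 2) * T := by
    by_contra! hcon
    choose w hw using fun n : ℕ => hcon (n + 1) (by positivity)
    obtain ⟨m, hmp, hminv, U, hU⟩ := exists_invariant_measure_tendsto hσ hadd w
    have : -(δ / 2) ≤ ∫ x, c x ∂m := by
      refine ge_of_tendsto (hU c hc) (Eventually.of_forall fun n => ?_)
      rw [inv_mul_eq_div, le_div_iff₀ (by positivity)]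
      exact (hw n).le
    linarith [h m hmp hminv]
  obtain ⟨M', hM'⟩ := (isCompact_range hc.norm).bddAbove
  set M := max M' 0
  have hM0 : 0 ≤ M := le_max_right _ _
  have hM : ∀ x, ‖c x‖ ≤ M := fun x => (hM' ⟨x, rfl⟩).trans (le_max_left _ _)
  have key : ∀ n : ℕ, ∀ ω, ∀ t ≥ (0:ℝ), t ≤ (n + 1) * T →
      ∫ s in (0:ℝ)..t, c (σ s ω) ≤ -(δ / 2) * t + (M + δ / 2) * T := by
    have small : ∀ ω, ∀ t ≥ (0:ℝ), t ≤ T →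
        ∫ s in (0:ℝ)..t, c (σ s ω) ≤ -(δ / 2) * t + (M + δ / 2) * T := by
      intro ω t ht htT
      have := intervalIntegral.norm_integral_le_of_norm_le_const (a := 0) (b := t)
        (f := fun s => c (σ s ω)) (C := M) (fun s _ => hM _)
      rw [sub_zero, abs_of_nonneg ht] at this
      have := (Real.le_norm_self _).trans this
      nlinarith
    intro n
    induction n with
    | zero => intro ω t ht htT; exact small ω t ht (by simpa using htT)
    | succ n ih =>
      intro ω t ht htT
      rcases le_total t T with htT' | htT'
      · exact small ω t ht htT'
      have := ih (σ T ω) (t - T) (by linarith) (by push_cast at htT; linarith)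
      simp only [← hadd] at this
      rw [intervalIntegral.integral_comp_add_right (fun s => c (σ s ω)), zero_add,
        sub_add_cancel] at this
      rw [← intervalIntegral.integral_add_adjacent_intervals (hi ω 0 T) (hi ω T t)]
      linarith [hneg ω]
  refine ⟨Real.exp ((M + δ / 2) * T), Real.one_le_exp (by positivity), δ / 2, by positivity,
    fun ω t ht => ?_⟩
  rw [← Real.exp_add, Real.exp_le_exp, add_comm]
  refine key ⌈t / T⌉₊ ω t ht ?_
  rw [← div_le_iff₀ hT]
  linarith [Nat.le_ceil (t / T)]

end Flow

/-- For a minimal continuous flow on a nonempty compact metric space and a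
continuous `a : Ω → ℝ`, the Sacker–Sell spectrum of `a` is exactly the interval
`[γ^i, γ^s]` of extremal values of `∫ a dm` over `σ`-invariant Borel probability measures. -/
theorem stmt1 {Ω : Type*} [MetricSpace Ω] [CompactSpace Ω] [Nonempty Ω]
    [MeasurableSpace Ω] [BorelSpace Ω]
    (σ : ℝ → Ω → Ω)
    (hσcont : Continuous fun p : ℝ × Ω => σ p.1 p.2)
    (hσ0 : ∀ ω, σ 0 ω = ω)
    (hσadd : ∀ s t ω, σ (s + t) ω = σ s (σ t ω))
    (hmin : ∀ ω : Ω, Dense (Set.range fun t => σ t ω))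
    (a : Ω → ℝ) (ha : Continuous a) :
    ∀ lam : ℝ,
      (¬ ExpDichotomy σ (fun ω => a ω - lam)) ↔
      (sInf {r : ℝ | ∃ m : Measure Ω, IsProbabilityMeasure m ∧
            (∀ t, Measure.map (σ t) m = m) ∧ r = ∫ ω, a ω ∂m} ≤ lam ∧
       lam ≤ sSup {r : ℝ | ∃ m : Measure Ω, IsProbabilityMeasure m ∧
            (∀ t, Measure.map (σ t) m = m) ∧ r = ∫ ω, a ω ∂m}) := by
  intro lam
  set S := {r : ℝ | ∃ m : Measure Ω, IsProbabilityMeasure m ∧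
            (∀ t, Measure.map (σ t) m = m) ∧ r = ∫ ω, a ω ∂m}
  have hne : S.Nonempty := by
    obtain ⟨m, hm, hinv, -⟩ := exists_invariant_measure_tendsto hσcont hσadd
      fun _ => Classical.arbitrary Ω
    exact ⟨_, m, hm, hinv, rfl⟩
  have hint : ∀ m : Measure Ω, IsProbabilityMeasure m → Integrable a m := fun m _ =>
    (BoundedContinuousFunction.mkOfCompact ⟨a, ha⟩).integrable m
  obtain ⟨M, hM⟩ := (isCompact_range ha.norm).bddAbove
  have habs : ∀ r ∈ S, |r| ≤ M := by
    rintro r ⟨m, hm, -, rfl⟩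
    simpa using norm_integral_le_of_norm_le_const (μ := m) (ae_of_all _ fun x => hM ⟨x, rfl⟩)
  have habove : BddAbove S := ⟨M, fun r hr => (abs_le.1 (habs r hr)).2⟩
  have hbelow : BddBelow S := ⟨-M, fun r hr => (abs_le.1 (habs r hr)).1⟩
  have hc : Continuous fun ω => a ω - lam := ha.sub continuous_const
  have hcint : ∀ m : Measure Ω, IsProbabilityMeasure m →
      ∫ ω, (a ω - lam) ∂m = ∫ ω, a ω ∂m - lam := fun m hm => by
    rw [integral_sub (hint m hm) (integrable_const _)]; simp
  have hτcont : Continuous fun p : ℝ × Ω => σ (-p.1) p.2 :=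
    hσcont.comp (continuous_fst.neg.prodMk continuous_snd)
  have hτadd : ∀ s t ω, σ (-(s + t)) ω = σ (-s) (σ (-t) ω) := fun s t ω => by
    rw [neg_add, hσadd]
  have hrev : ∀ ω t, ∫ s in (0:ℝ)..t, -(a (σ (-s) ω) - lam)
      = ∫ s in (0:ℝ)..(-t), (a (σ s ω) - lam) := fun ω t => by
    rw [intervalIntegral.integral_neg,
      intervalIntegral.integral_comp_neg (fun s => a (σ s ω) - lam), neg_zero,
      intervalIntegral.integral_symm, neg_neg]
  rw [not_iff_comm, not_and_or, not_le, not_le]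
  constructor
  · rintro (hlt | hlt)
    · obtain ⟨κ, hκ, γ, hγ, h⟩ := exists_exp_le_of_integral_le (σ := fun t => σ (-t))
        (c := fun ω => -(a ω - lam)) hτcont hτadd hc.neg
        (sub_pos.2 hlt) fun m hm hinv => by
          have := csInf_le hbelow
            (show ∫ ω, a ω ∂m ∈ S from ⟨m, hm, fun t => by simpa using hinv (-t), rfl⟩)
          rw [integral_neg, hcint m hm]
          linarith
      refine ⟨κ, hκ, γ, hγ, Or.inr fun ω t ht => ?_⟩
      have := h ω (-t) (by linarith)
      rw [hrev] at this
      simpa using this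
    · obtain ⟨κ, hκ, γ, hγ, h⟩ := exists_exp_le_of_integral_le hσcont hσadd hc
        (sub_pos.2 hlt) fun m hm hinv => by
          have := le_csSup habove (show ∫ ω, a ω ∂m ∈ S from ⟨m, hm, hinv, rfl⟩)
          rw [hcint m hm]
          linarith
      exact ⟨κ, hκ, γ, hγ, Or.inl h⟩
  · rintro ⟨κ, hκ, γ, hγ, h | h⟩
    · right
      have : sSup S ≤ lam - γ := by
        refine csSup_le hne ?_
        rintro r ⟨m, hm, hinv, rfl⟩
        have := integral_le_neg_of_exp_le hσcont hc hκ h m hinv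
        rw [hcint m hm] at this
        linarith
      linarith
    · left
      have : lam + γ ≤ sInf S := by
        refine le_csInf hne ?_
        rintro r ⟨m, hm, hinv, rfl⟩
        have := integral_le_neg_of_exp_le (σ := fun t => σ (-t))
          (c := fun ω => -(a ω - lam)) hτcont hc.neg hκ (γ := γ) (fun ω t ht => by
          rw [hrev]
          simpa using h ω (-t) (by linarith)) m fun t => hinv (-t)
        rw [integral_neg, hcint m hm] at this
        linarith
      linarith
end

section
/- Let σ be a minimal, non-periodic continuous flow on a nonempty compact metric space Ω, let m be a σ-invariant Borel probability measure on Ω, let ω₀ ∈ Ω and ε > 0. Then there exist a continuous function b : Ω → ℝ with sup_{ω ∈ Ω} |b(ω)| ≤ ε and a continuous function h : Ω → [0,1] such that h(ω·t) − h(ω) = ∫_0^t b(ω·s) ds for all ω ∈ Ω and t ∈ ℝ, h(ω₀) = 1, and ∫_Ω h dm ≤ ε. -/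
open MeasureTheory

/-- A compact orbit segment of an injective orbit is null for every invariant finite measure. -/
theorem measure_orbit_segment_eq_zero {Ω : Type*} [TopologicalSpace Ω] [T2Space Ω]
    [MeasurableSpace Ω] [BorelSpace Ω] {σ : ℝ → Ω → Ω}
    (hσcont : Continuous fun p : ℝ × Ω => σ p.1 p.2)
    (hσadd : ∀ s t ω, σ (s + t) ω = σ s (σ t ω))
    {m : Measure Ω} [IsFiniteMeasure m] (hminv : ∀ t, Measure.map (σ t) m = m)
    {ω₀ : Ω} (hnp : Function.Injective fun t : ℝ => σ t ω₀) {L : ℝ} (hL : 0 < L) :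
    m ((fun t => σ t ω₀) '' Set.Icc 0 L) = 0 := by
  have hK : IsCompact ((fun t => σ t ω₀) '' Set.Icc 0 L) :=
    isCompact_Icc.image (hσcont.comp (by fun_prop : Continuous fun t : ℝ => (t, ω₀)))
  have hpres : MeasurePreserving (σ (L + 1)) m m :=
    ⟨(hσcont.comp (by fun_prop : Continuous fun ω : Ω => (L + 1, ω))).measurable, hminv _⟩
  by_contra hne
  obtain ⟨_, ⟨s, hs, rfl⟩, n, hn, s', hs', heq⟩ :=
    hpres.exists_mem_iterate_mem hK.measurableSet.nullMeasurableSet hne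
  have hiter : ∀ k : ℕ, (σ (L + 1))^[k] (σ s ω₀) = σ (k * (L + 1) + s) ω₀ := by
    intro k
    induction k with
    | zero => simp
    | succ k ih =>
      rw [Function.iterate_succ_apply', ih, ← hσadd]
      congr 1
      push_cast
      ring
  have hinj : s' = n * (L + 1) + s := hnp (heq.trans (hiter n))
  have hn1 : (1 : ℝ) ≤ n := by exact_mod_cast Nat.one_le_iff_ne_zero.mpr hn
  nlinarith [hs.1, hs'.2]

/-- A closed null set of a normal space is contained in `{f = 1}` for some continuous
`[0,1]`-valued function `f` of arbitrarily small integral. -/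
theorem exists_continuous_one_on_integral_le {Ω : Type*} [TopologicalSpace Ω] [NormalSpace Ω]
    [MeasurableSpace Ω] [BorelSpace Ω] {m : Measure Ω} [IsFiniteMeasure m] [m.OuterRegular]
    {K : Set Ω} (hK : IsClosed K) (hm : m K = 0) {ε : ℝ} (hε : 0 < ε) :
    ∃ f : Ω → ℝ, Continuous f ∧ (∀ ω, f ω ∈ Set.Icc (0 : ℝ) 1) ∧ (∀ ω ∈ K, f ω = 1) ∧
      ∫ ω, f ω ∂m ≤ ε := by
  obtain ⟨U, hKU, hU, hUm⟩ := K.exists_isOpen_lt_of_lt (μ := m) (ENNReal.ofReal ε)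
    (by rw [hm]; exact ENNReal.ofReal_pos.mpr hε)
  obtain ⟨f, hf0, hf1, hf⟩ := exists_continuous_zero_one_of_isClosed hU.isClosed_compl hK
    (Set.disjoint_compl_left_iff_subset.mpr hKU)
  refine ⟨f, f.continuous, hf, fun ω hω => hf1 hω, ?_⟩
  calc ∫ ω, f ω ∂m ≤ ∫ ω, U.indicator (fun _ => (1 : ℝ)) ω ∂m := by
        refine integral_mono_of_nonneg (.of_forall fun ω => (hf ω).1)
          ((integrable_const 1).indicator hU.measurableSet) (.of_forall fun ω => ?_)
        by_cases hω : ω ∈ U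
        · simpa [hω] using (hf ω).2
        · simpa [hω] using (hf0 hω).le
    _ = m.real U := by
        rw [integral_indicator hU.measurableSet]; simp
    _ ≤ ε := ENNReal.toReal_le_of_le_ofReal hε.le hUm.le

/-- For a minimal non-periodic continuous flow on a nonempty compact metric
space, a `σ`-invariant Borel probability measure `m`, a point `ω₀` and `ε > 0`, there exist
a continuous `b : Ω → ℝ` with `‖b‖_∞ ≤ ε` admitting a continuous primitive `h : Ω → [0,1]`
with `h(ω₀) = 1` and `∫ h dm ≤ ε`. -/
theorem stmt2 {Ω : Type*} [MetricSpace Ω] [CompactSpace Ω] [Nonempty Ω]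
    [MeasurableSpace Ω] [BorelSpace Ω]
    (σ : ℝ → Ω → Ω)
    (hσcont : Continuous fun p : ℝ × Ω => σ p.1 p.2)
    (hσ0 : ∀ ω, σ 0 ω = ω)
    (hσadd : ∀ s t ω, σ (s + t) ω = σ s (σ t ω))
    (hmin : ∀ ω : Ω, Dense (Set.range fun t => σ t ω))
    (hnp : ∀ ω : Ω, Function.Injective fun t : ℝ => σ t ω)
    (m : Measure Ω) [IsProbabilityMeasure m]
    (hminv : ∀ t, Measure.map (σ t) m = m)
    (ω₀ : Ω) (ε : ℝ) (hε : 0 < ε) :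
    ∃ b : Ω → ℝ, Continuous b ∧ (∀ ω, |b ω| ≤ ε) ∧
      ∃ h : Ω → ℝ, Continuous h ∧ (∀ ω, h ω ∈ Set.Icc (0:ℝ) 1) ∧
        (∀ ω t, h (σ t ω) - h ω = ∫ s in (0:ℝ)..t, b (σ s ω)) ∧
        h ω₀ = 1 ∧ ∫ ω, h ω ∂m ≤ ε := by
  obtain ⟨L, hL, hLε⟩ : ∃ L : ℝ, 0 < L ∧ L⁻¹ = ε := ⟨ε⁻¹, inv_pos.mpr hε, inv_inv ε⟩
  have horb : ∀ ω, Continuous fun t => σ t ω := fun ω =>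
    hσcont.comp (by fun_prop : Continuous fun t : ℝ => (t, ω))
  have hmap : ∀ t, Continuous (σ t) := fun t =>
    hσcont.comp (by fun_prop : Continuous fun ω : Ω => (t, ω))
  obtain ⟨f, hfc, hf, hf1, hfm⟩ := exists_continuous_one_on_integral_le
    (isCompact_Icc.image (horb ω₀)).isClosed
    (measure_orbit_segment_eq_zero hσcont hσadd hminv (hnp ω₀) hL) hε
  have hfσ : Continuous fun p : Ω × ℝ => f (σ p.2 p.1) :=
    hfc.comp (hσcont.comp continuous_swap)
  have hg : ∀ ω, Continuous fun t => f (σ t ω) := fun ω => hfc.comp (horb ω)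
  have hgi : ∀ ω a b, IntervalIntegrable (fun t => f (σ t ω)) volume a b :=
    fun ω a b => (hg ω).intervalIntegrable a b
  refine ⟨fun ω => L⁻¹ * (f (σ L ω) - f ω), by have := hmap L; fun_prop, fun ω => ?_,
    fun ω => L⁻¹ * ∫ s in (0 : ℝ)..L, f (σ s ω), ?_, fun ω => ⟨?_, ?_⟩, fun ω t => ?_, ?_, ?_⟩
  · rw [abs_mul, abs_of_pos (inv_pos.mpr hL), hLε]
    have h1 := hf (σ L ω)
    have h2 := hf ω
    exact mul_le_of_le_one_right hε.le (abs_le.mpr ⟨by linarith [h1.1, h2.2],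
      by linarith [h1.2, h2.1]⟩)
  · exact continuous_const.mul
      (intervalIntegral.continuous_parametric_intervalIntegral_of_continuous' hfσ 0 L)
  · exact mul_nonneg (inv_pos.mpr hL).le
      (intervalIntegral.integral_nonneg hL.le fun s _ => (hf _).1)
  · have h1 : ∫ s in (0 : ℝ)..L, f (σ s ω) ≤ ∫ _ in (0 : ℝ)..L, (1 : ℝ) :=
      intervalIntegral.integral_mono_on hL.le (hgi ω 0 L) (by simp) fun s _ => (hf _).2
    rw [inv_mul_le_iff₀ hL]
    simpa using h1
  · simp only [← hσadd]
    rw [intervalIntegral.integral_const_mul, ← mul_sub,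
      intervalIntegral.integral_sub (f := fun s => f (σ (L + s) ω))
        (((hg ω).comp (continuous_const_add L)).intervalIntegrable 0 t)
        (hgi ω 0 t),
      intervalIntegral.integral_comp_add_right (fun s => f (σ s ω)),
      intervalIntegral.integral_comp_add_left (fun s => f (σ s ω))]
    have h1 := intervalIntegral.integral_add_adjacent_intervals (hgi ω 0 t) (hgi ω t (L + t))
    have h2 := intervalIntegral.integral_add_adjacent_intervals (hgi ω 0 L) (hgi ω L (L + t))
    rw [zero_add, add_zero]
    congr 1
    linarith
  · have h1 : ∫ s in (0 : ℝ)..L, f (σ s ω₀) = ∫ _ in (0 : ℝ)..L, (1 : ℝ) := by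
      refine intervalIntegral.integral_congr fun s hs => hf1 _ ⟨s, ?_, rfl⟩
      rwa [Set.uIcc_of_le hL.le] at hs
    simp only [h1]
    simp [hL.ne']
  · have hinv : ∀ s, ∫ ω, f (σ s ω) ∂m = ∫ ω, f ω ∂m := fun s => by
      rw [← integral_map (hmap s).aemeasurable hfc.aestronglyMeasurable, hminv]
    have hint : Integrable (Function.uncurry fun ω s => f (σ s ω))
        (m.prod (volume.restrict (Set.Ioc 0 L))) :=
      .of_bound (C := 1) hfσ.aestronglyMeasurable (.of_forall fun p => by
        rw [Function.uncurry, Real.norm_of_nonneg (hf _).1]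
        exact (hf _).2)
    simp only [intervalIntegral.integral_of_le hL.le]
    rw [integral_const_mul, integral_integral_swap hint]
    simp only [hinv]
    rw [← intervalIntegral.integral_of_le hL.le, intervalIntegral.integral_const, smul_eq_mul,
      sub_zero, inv_mul_cancel_left₀ hL.ne']
    exact hfm
end

section
/- Let σ be a minimal, non-periodic continuous flow on a nonempty compact metric space Ω. Then there exists a continuous function a : Ω → ℝ such that: (1) ∫_Ω a dm̃ = 0 for every σ-invariant Borel probability measure m̃ on Ω (equivalently, the Sacker–Sell spectrum of a is {0}); (2) a does not admit a continuous primitive; (3) for every σ-invariant Borel probability measure m̃ on Ω, sup_{t ≤ 0} ∫_0^t a(ω·s) ds < ∞ for m̃-almost every ω ∈ Ω. In particular, a belongs to R_{m̃}(Ω) for every σ-invariant Borel probability measure m̃. -/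
open MeasureTheory

/-- A nonnegative function, slowly varying along the flow and supported on a set that is small for
every invariant probability measure, which vanishes at `ω₀` but is large somewhere on its orbit. -/
theorem exists_slowly_varying_bump {Ω : Type*} [MetricSpace Ω] [MeasurableSpace Ω] [BorelSpace Ω]
    (σ : ℝ → Ω → Ω)
    (hσcont : Continuous fun p : ℝ × Ω => σ p.1 p.2)
    (hσ0 : ∀ ω, σ 0 ω = ω)
    (hσadd : ∀ s t ω, σ (s + t) ω = σ s (σ t ω))
    (hnp : ∀ ω : Ω, Function.Injective fun t : ℝ => σ t ω)
    (ω₀ : Ω) {ε K : ℝ} (hε : 0 < ε) (hK : 0 ≤ K) :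
    ∃ h : Ω → ℝ, Continuous h ∧ (∀ ω, 0 ≤ h ω) ∧
      (∀ ω r, |h (σ r ω) - h ω| ≤ ε * |r|) ∧ h ω₀ = 0 ∧ (∃ t, K ≤ h (σ t ω₀)) ∧
      ∀ m : Measure Ω, IsProbabilityMeasure m → (∀ t, Measure.map (σ t) m = m) →
        m {ω | h ω ≠ 0} ≤ ENNReal.ofReal ε := by
  have hcont : ∀ t, Continuous (σ t) := fun t => hσcont.comp₂ (by fun_prop) (by fun_prop)
  have hL : 0 ≤ K / ε := by positivity
  set L := K / ε with hLdef
  have hLε : ε * L = K := by rw [hLdef]; field_simp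
  obtain ⟨n, hn⟩ := exists_nat_one_div_lt hε
  set P := 2 * L + 1 with hP
  set M := (n + 1) * P + 2 * L with hM
  set x := σ (L + 1) ω₀ with hx
  have hret : ∀ᶠ p : Ω × Ω in nhds (x, x), ∀ t ∈ Set.Icc 1 M, σ t p.1 ≠ p.2 := by
    refine isCompact_Icc.eventually_forall_of_forall_eventually fun t ht => ?_
    refine (isOpen_ne_fun (f := fun z : (Ω × Ω) × ℝ => σ z.2 z.1.1) (g := fun z => z.1.2)
      (hσcont.comp₂ (by fun_prop) (by fun_prop)) (by fun_prop)).eventually_mem ?_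
    intro h
    have := hnp x (a₁ := t) (a₂ := 0) (by simpa [hσ0] using h)
    linarith [ht.1]
  have havoid : ∀ᶠ y : Ω in nhds x, ∀ s ∈ Set.Icc (-L) L, σ s ω₀ ≠ y := by
    refine isCompact_Icc.eventually_forall_of_forall_eventually fun s hs => ?_
    refine (isOpen_ne_fun (f := fun z : Ω × ℝ => σ z.2 ω₀) (g := fun z => z.1)
      (hσcont.comp₂ (by fun_prop) (by fun_prop)) (by fun_prop)).eventually_mem ?_
    intro h
    have := hnp ω₀ (a₁ := s) (a₂ := L + 1) h
    linarith [hs.2]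
  obtain ⟨δ, hδ, hball⟩ : ∃ δ > 0, ∀ y, dist y x < δ → (∀ s ∈ Set.Icc (-L) L, σ s ω₀ ≠ y) ∧
      ∀ z, dist z x < δ → ∀ t ∈ Set.Icc 1 M, σ t y ≠ z := by
    obtain ⟨d₁, hd₁, h₁⟩ := Metric.eventually_nhds_iff.1 hret
    obtain ⟨d₂, hd₂, h₂⟩ := Metric.eventually_nhds_iff.1 havoid
    refine ⟨min d₁ d₂, lt_min hd₁ hd₂, fun y hy => ⟨h₂ (hy.trans_le (min_le_right _ _)),
      fun z hz => h₁ (y := (y, z)) ?_⟩⟩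
    rw [Prod.dist_eq]
    exact max_lt (hy.trans_le (min_le_left _ _)) (hz.trans_le (min_le_left _ _))
  set φ : Ω → ℝ := fun y => max 0 (1 - dist y x / δ) with hφ
  have hφ0 : ∀ y, 0 ≤ φ y := fun y => le_max_left _ _
  have hφ1 : ∀ y, φ y ≤ 1 := fun y => max_le zero_le_one (sub_le_self _ (by positivity))
  have hφB : ∀ y, φ y ≠ 0 → dist y x < δ := by
    intro y hy
    by_contra! hd
    refine hy (max_eq_left ?_)
    rw [sub_nonpos, le_div_iff₀ hδ, one_mul]
    exact hd
  have hφx : φ x = 1 := by simp [hφ]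
  set T : ℝ → ℝ := fun s => max 0 (K - ε * |s|) with hT
  have hT0 : ∀ s, 0 ≤ T s := fun s => le_max_left _ _
  have hTL : ∀ s, s ∉ Set.Icc (-L) L → T s = 0 := by
    intro s hs
    refine max_eq_left ?_
    have : L < |s| := by
      by_contra! hc
      exact hs (abs_le.1 hc)
    nlinarith
  have hTlip : ∀ s r, T s ≤ T (s + r) + ε * |r| := by
    intro s r
    refine max_le (add_nonneg (hT0 _) (by positivity)) ?_
    have h₁ : K - ε * |s + r| ≤ T (s + r) := le_max_right _ _
    have h₂ := abs_add_le s r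
    nlinarith
  set f : Ω → ℝ → ℝ := fun ω s => φ (σ s ω) * T s with hf
  have hfc : Continuous (Function.uncurry f) := by
    have : Continuous fun p : Ω × ℝ => σ p.2 p.1 := hσcont.comp₂ (by fun_prop) (by fun_prop)
    simp only [hf, hφ, hT, Function.uncurry_def]
    fun_prop
  have hf0 : ∀ ω s, 0 ≤ f ω s := fun ω s => mul_nonneg (hφ0 _) (hT0 _)
  set h : Ω → ℝ := fun ω => sSup (f ω '' Set.Icc (-L) L) with hh
  have hcompact : ∀ ω, IsCompact (f ω '' Set.Icc (-L) L) := fun ω =>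
    isCompact_Icc.image (hfc.comp (by fun_prop : Continuous fun s : ℝ => (ω, s)))
  have hzero : (0 : ℝ) ∈ Set.Icc (-L) L := ⟨by linarith, hL⟩
  have hh0 : ∀ ω, 0 ≤ h ω := fun ω =>
    (hf0 ω 0).trans (le_csSup (hcompact ω).bddAbove ⟨0, hzero, rfl⟩)
  have hle : ∀ ω s, f ω s ≤ h ω := by
    intro ω s
    by_cases hs : s ∈ Set.Icc (-L) L
    · exact le_csSup (hcompact ω).bddAbove ⟨s, hs, rfl⟩
    · simpa [hf, hTL s hs] using hh0 ω
  have hge : ∀ ω c, (∀ s ∈ Set.Icc (-L) L, f ω s ≤ c) → h ω ≤ c := by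
    intro ω c hc
    refine csSup_le ⟨_, 0, hzero, rfl⟩ ?_
    rintro _ ⟨s, hs, rfl⟩
    exact hc s hs
  have hlip : ∀ ω r, h (σ r ω) ≤ h ω + ε * |r| := by
    intro ω r
    refine hge _ _ fun s _ => ?_
    have h₁ := hle ω (s + r)
    have h₂ := hTlip s r
    simp only [hf, ← hσadd] at h₁ ⊢
    have h₃ := hφ0 (σ (s + r) ω)
    have h₄ := hφ1 (σ (s + r) ω)
    have h₅ : 0 ≤ ε * |r| := by positivity
    nlinarith
  have hsupp : ∀ ω, h ω ≠ 0 → ∃ s ∈ Set.Icc (-L) L, dist (σ s ω) x < δ := by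
    intro ω hω
    by_contra! hc
    refine hω (le_antisymm (hge _ _ fun s hs => ?_) (hh0 ω))
    have : φ (σ s ω) = 0 := by
      by_contra hne
      exact absurd (hφB _ hne) (not_lt.2 (hc s hs))
    simp [hf, this]
  have hhc : Continuous h := isCompact_Icc.continuous_sSup hfc
  refine ⟨h, hhc, hh0, ?_, ?_, ⟨L + 1, ?_⟩, ?_⟩
  · intro ω r
    have h₁ := hlip ω r
    have h₂ := hlip (σ r ω) (-r)
    rw [← hσadd, neg_add_cancel, hσ0, abs_neg] at h₂
    rw [abs_le]
    constructor <;> linarith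
  · by_contra hne
    obtain ⟨s, hs, hd⟩ := hsupp _ hne
    exact (hball _ hd).1 s hs rfl
  · refine le_trans ?_ (hle _ 0)
    simp [hf, hσ0, ← hx, hφx, hT]
  · intro m hm hinv
    set A := {ω | h ω ≠ 0} with hA
    have hAm : MeasurableSet A := (isOpen_ne_fun hhc continuous_const).measurableSet
    have hpre : ∀ t, m (σ t ⁻¹' A) = m A := fun t => by
      rw [← Measure.map_apply (hcont t).measurable hAm, hinv]
    have hlt : ∀ i j : ℕ, i < j → j < n + 1 →
        Disjoint (σ (i * P) ⁻¹' A) (σ (j * P) ⁻¹' A) := by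
      intro i j hij hj
      refine Set.disjoint_left.2 fun ω hi hj' => ?_
      obtain ⟨s, hs, hd⟩ := hsupp _ hi
      obtain ⟨s', hs', hd'⟩ := hsupp _ hj'
      have hij' : (i : ℝ) + 1 ≤ j := by exact_mod_cast hij
      have hjn : (j : ℝ) ≤ n + 1 := by exact_mod_cast hj.le
      have hi0 : (0 : ℝ) ≤ i := i.cast_nonneg
      have hPpos : 0 < P := by linarith
      refine (hball _ hd).2 _ hd' ((j * P + s') - (i * P + s)) ⟨?_, ?_⟩ ?_
      · nlinarith [hs.2, hs'.1]
      · nlinarith [hs.1, hs'.2]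
      · rw [← hσadd, ← hσadd, ← hσadd]
        congr 1
        ring
    have hdisj : (↑(Finset.range (n + 1)) : Set ℕ).PairwiseDisjoint
        fun i : ℕ => σ (i * P) ⁻¹' A := by
      intro i hi j hj hne
      simp only [Finset.coe_range, Set.mem_Iio] at hi hj
      rcases lt_or_gt_of_ne hne with hlt' | hlt'
      · exact hlt i j hlt' hj
      · exact (hlt j i hlt' hi).symm
    have hsum := measure_biUnion_finset (μ := m) hdisj
      fun i _ => (hcont _).measurable hAm
    simp only [hpre, Finset.sum_const, Finset.card_range, nsmul_eq_mul] at hsum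
    have hone : ((n + 1 : ℕ) : ENNReal) * m A ≤ 1 := hsum ▸ prob_le_one
    calc m A ≤ 1 / ((n + 1 : ℕ) : ENNReal) := by
          rw [ENNReal.le_div_iff_mul_le (by simp) (by simp), mul_comm]
          exact hone
      _ = ENNReal.ofReal (1 / ((n : ℝ) + 1)) := by
          rw [ENNReal.ofReal_div_of_pos (by positivity), ENNReal.ofReal_one]
          congr 1
          exact_mod_cast (ENNReal.ofReal_natCast (n + 1)).symm
      _ ≤ ENNReal.ofReal ε := ENNReal.ofReal_le_ofReal hn.le

/-- The time-one increment of `h` along a flow is a coboundary: its primitive is the average of `h`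
over orbit segments of length one. -/
theorem integral_unit_increment_along_flow {Ω : Type*} [TopologicalSpace Ω]
    (σ : ℝ → Ω → Ω)
    (hσcont : Continuous fun p : ℝ × Ω => σ p.1 p.2)
    (hσadd : ∀ s t ω, σ (s + t) ω = σ s (σ t ω))
    {h : Ω → ℝ} (hh : Continuous h) (ω : Ω) (t : ℝ) :
    ∫ s in (0:ℝ)..t, (h (σ s ω) - h (σ 1 (σ s ω))) =
      (∫ s in (0:ℝ)..1, h (σ s ω)) - ∫ s in (0:ℝ)..1, h (σ s (σ t ω)) := by
  have hc : Continuous fun s => h (σ s ω) := hh.comp (hσcont.comp₂ (by fun_prop) (by fun_prop))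
  have hi : ∀ a b, IntervalIntegrable (fun s => h (σ s ω)) volume a b :=
    fun a b => hc.intervalIntegrable a b
  have hc₁ : Continuous fun s => h (σ (1 + s) ω) := hc.comp (by fun_prop)
  simp only [← hσadd]
  rw [intervalIntegral.integral_sub (hi _ _) (hc₁.intervalIntegrable _ _),
    intervalIntegral.integral_comp_add_left (fun s => h (σ s ω)) 1,
    intervalIntegral.integral_comp_add_right (fun s => h (σ s ω)) t]
  have e₁ := intervalIntegral.integral_add_adjacent_intervals (hi 0 1) (hi 1 (1 + t))
  have e₂ := intervalIntegral.integral_add_adjacent_intervals (hi 0 t) (hi t (1 + t))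
  rw [zero_add, add_zero]
  linarith

/-- For a minimal non-periodic continuous flow on a nonempty compact metric
space there exists a continuous `a : Ω → ℝ` with zero integral with respect to every
`σ`-invariant Borel probability measure, not admitting a continuous primitive, and such
that, for every `σ`-invariant Borel probability measure `m̃`,
`sup_{t ≤ 0} ∫_0^t a(ω·s) ds < ∞` for `m̃`-almost every `ω`.  Hence `a ∈ R_{m̃}(Ω)` for
every such `m̃`. -/
theorem stmt4 {Ω : Type*} [MetricSpace Ω] [CompactSpace Ω] [Nonempty Ω]
    [MeasurableSpace Ω] [BorelSpace Ω]
    (σ : ℝ → Ω → Ω)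
    (hσcont : Continuous fun p : ℝ × Ω => σ p.1 p.2)
    (hσ0 : ∀ ω, σ 0 ω = ω)
    (hσadd : ∀ s t ω, σ (s + t) ω = σ s (σ t ω))
    (hmin : ∀ ω : Ω, Dense (Set.range fun t => σ t ω))
    (hnp : ∀ ω : Ω, Function.Injective fun t : ℝ => σ t ω) :
    ∃ a : Ω → ℝ, Continuous a ∧
      (∀ m' : Measure Ω, IsProbabilityMeasure m' → (∀ t, Measure.map (σ t) m' = m') →
        ∫ ω, a ω ∂m' = 0) ∧
      (¬ ∃ h : Ω → ℝ, Continuous h ∧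
        ∀ ω t, h (σ t ω) - h ω = ∫ s in (0:ℝ)..t, a (σ s ω)) ∧
      (∀ m' : Measure Ω, IsProbabilityMeasure m' → (∀ t, Measure.map (σ t) m' = m') →
        ∀ᵐ ω ∂m', ∃ C : ℝ, ∀ t ≤ (0:ℝ), (∫ s in (0:ℝ)..t, a (σ s ω)) ≤ C) := by
  have hcont : ∀ t, Continuous (σ t) := fun t => hσcont.comp₂ (by fun_prop) (by fun_prop)
  have hpath : ∀ ω, Continuous fun t => σ t ω := fun ω => hσcont.comp₂ (by fun_prop) (by fun_prop)
  obtain ⟨ω₀⟩ := ‹Nonempty Ω›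
  set ε : ℕ → ℝ := fun k => (1 / 2) ^ k with hεdef
  have hε : ∀ k, 0 < ε k := fun k => by positivity
  have hεsum : Summable ε := summable_geometric_two
  choose h hhc hh0 hlip hω₀ hbig hmeas using fun k : ℕ =>
    exists_slowly_varying_bump σ hσcont hσ0 hσadd hnp ω₀ (hε k) (Nat.cast_nonneg k)
  set b : ℕ → Ω → ℝ := fun k ω => h k ω - h k (σ 1 ω) with hb
  have hbc : ∀ k, Continuous (b k) := fun k => (hhc k).sub ((hhc k).comp (hcont 1))
  have hbε : ∀ k ω, ‖b k ω‖ ≤ ε k := fun k ω => by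
    simpa [hb, abs_sub_comm] using hlip k ω 1
  set H : ℕ → Ω → ℝ := fun k ω => ∫ s in (0:ℝ)..1, h k (σ s ω) with hH
  have hHint : ∀ k ω, IntervalIntegrable (fun s => h k (σ s ω)) volume 0 1 := fun k ω =>
    ((hhc k).comp (hpath ω)).intervalIntegrable _ _
  have hH0 : ∀ k ω, 0 ≤ H k ω := fun k ω =>
    intervalIntegral.integral_nonneg zero_le_one fun s _ => hh0 k _
  have hclose : ∀ k ω, ∀ s ∈ Set.Icc (0 : ℝ) 1, |h k (σ s ω) - h k ω| ≤ ε k := by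
    intro k ω s hs
    refine (hlip k ω s).trans (mul_le_of_le_one_right (hε k).le ?_)
    rw [abs_of_nonneg hs.1]
    exact hs.2
  have hHle : ∀ k ω, H k ω ≤ h k ω + ε k := by
    intro k ω
    have := intervalIntegral.integral_mono_on zero_le_one (hHint k ω)
      (intervalIntegrable_const (c := h k ω + ε k)) fun s hs => by
        linarith [(abs_le.1 (hclose k ω s hs)).2]
    simpa using this
  have hHge : ∀ k ω, h k ω - ε k ≤ H k ω := by
    intro k ω
    have := intervalIntegral.integral_mono_on zero_le_one
      (intervalIntegrable_const (c := h k ω - ε k)) (hHint k ω) fun s hs => by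
        linarith [(abs_le.1 (hclose k ω s hs)).1]
    simpa using this
  have hsum : ∀ ω t, HasSum (fun k => H k ω - H k (σ t ω))
      (∫ s in (0:ℝ)..t, ∑' k, b k (σ s ω)) := by
    intro ω t
    have := intervalIntegral.hasSum_intervalIntegral_of_summable_norm (a := 0) (b := t)
      (f := fun k => (⟨fun s => b k (σ s ω), (hbc k).comp (hpath ω)⟩ : C(ℝ, ℝ)))
      (hεsum.of_nonneg_of_le (fun _ => norm_nonneg _) fun k =>
        (ContinuousMap.norm_le _ (hε k).le).2 fun s => hbε k _)
    simpa only [ContinuousMap.coe_mk, hb,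
      integral_unit_increment_along_flow σ hσcont hσadd (hhc _)] using this
  refine ⟨fun ω => ∑' k, b k ω, continuous_tsum hbc hεsum hbε, ?_, ?_, ?_⟩
  · intro m hm hinv
    have hint : ∀ k, Integrable (h k) m := fun k =>
      (hhc k).integrable_of_hasCompactSupport (HasCompactSupport.of_compactSpace _)
    have hint' : ∀ k, Integrable (b k) m := fun k =>
      (hbc k).integrable_of_hasCompactSupport (HasCompactSupport.of_compactSpace _)
    have hshift : ∀ k, ∫ ω, h k (σ 1 ω) ∂m = ∫ ω, h k ω ∂m := fun k => by
      conv_rhs => rw [← hinv 1]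
      exact (integral_map (hcont 1).aemeasurable (hhc k).aestronglyMeasurable).symm
    have hb0 : ∀ k, ∫ ω, b k ω ∂m = 0 := fun k => by
      have : Integrable (fun ω => h k (σ 1 ω)) m :=
        ((hhc k).comp (hcont 1)).integrable_of_hasCompactSupport
          (HasCompactSupport.of_compactSpace _)
      simp only [hb]
      rw [integral_sub (hint k) this, hshift, sub_self]
    have hnorm : ∀ k, ∫ ω, ‖b k ω‖ ∂m ≤ ε k := fun k => by
      simpa using integral_mono (hint' k).norm (integrable_const (ε k)) (hbε k)
    rw [← integral_tsum_of_summable_integral_norm hint'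
      (hεsum.of_nonneg_of_le (fun k => integral_nonneg fun _ => norm_nonneg _) hnorm)]
    simp [hb0]
  · rintro ⟨g, hgc, hg⟩
    obtain ⟨C, hC⟩ := isCompact_univ.exists_bound_of_continuousOn hgc.continuousOn
    have hle : ∀ k : ℕ, (k : ℝ) ≤ 2 * C + (∑' j, ε j) + 1 := by
      intro k
      obtain ⟨t, ht⟩ := hbig k
      have hdiff := hsum ω₀ t
      rw [← hg ω₀ t] at hdiff
      have hterm : ∀ j, H j ω₀ - H j (σ t ω₀) ≤ ε j - if j = k then (k : ℝ) - ε k else 0 := by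
        intro j
        have h₁ : H j ω₀ ≤ ε j := by simpa [hω₀ j] using hHle j ω₀
        split_ifs with hjk
        · subst hjk
          linarith [hHge j (σ t ω₀)]
        · linarith [hH0 j (σ t ω₀)]
      have := hasSum_le hterm hdiff (hεsum.hasSum.sub (hasSum_ite_eq k ((k : ℝ) - ε k)))
      have h₁ := abs_le.1 (hC (σ t ω₀) trivial)
      have h₂ := abs_le.1 (hC ω₀ trivial)
      have h₃ : ε k ≤ 1 := pow_le_one₀ (by norm_num) (by norm_num)
      linarith [h₁.1, h₂.2]
    obtain ⟨k, hk⟩ := exists_nat_gt (2 * C + (∑' j, ε j) + 1)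
    exact absurd (hle k) (not_le.2 hk)
  · intro m hm hinv
    have hBC : ∀ᵐ ω ∂m, ∀ᶠ k in Filter.atTop, ω ∉ {ω | h k ω ≠ 0} := by
      refine ae_eventually_notMem (ne_top_of_le_ne_top hεsum.tsum_ofReal_ne_top ?_)
      exact ENNReal.tsum_le_tsum fun k => hmeas k m hm hinv
    filter_upwards [hBC] with ω hω
    have hHsum : Summable fun k => H k ω := by
      refine hεsum.of_norm_bounded_eventually_nat ?_
      filter_upwards [hω] with k hk
      have hk0 : h k ω = 0 := by simpa using hk
      rw [Real.norm_of_nonneg (hH0 k ω)]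
      simpa [hk0] using hHle k ω
    refine ⟨∑' k, H k ω, fun t _ => ?_⟩
    exact hasSum_le (fun k => sub_le_self _ (hH0 k _)) (hsum ω t) hHsum.hasSum
end

section
/- Let σ be a minimal, non-periodic continuous flow on a nonempty compact metric space Ω, let m be a σ-invariant Borel probability measure on Ω, and suppose a ∈ R_m(Ω). Then there exists a σ-ergodic Borel probability measure m̃ on Ω such that a ∈ R_{m̃}(Ω). -/
open MeasureTheory

section

open Filter Topology ProbabilityTheory Set

theorem exists_seq_continuousMap_separating_measures (Ω : Type*) [MetricSpace Ω] [CompactSpace Ω]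
    [MeasurableSpace Ω] [BorelSpace Ω] :
    ∃ f : ℕ → C(Ω, ℝ), ∀ μ ν : ProbabilityMeasure Ω,
      (∀ n, ∫ x, f n x ∂μ = ∫ x, f n x ∂ν) → μ = ν := by
  refine ⟨TopologicalSpace.denseSeq C(Ω, ℝ), fun μ ν h => ?_⟩
  have hc : ∀ μ : ProbabilityMeasure Ω,
      Continuous fun f : C(Ω, ℝ) => ∫ x, f x ∂(μ : Measure Ω) := by
    intro μ
    refine (LipschitzWith.of_dist_le_mul (K := 1) fun f g => ?_).continuous
    have hi : ∀ f : C(Ω, ℝ), Integrable (fun x => f x) (μ : Measure Ω) := fun f =>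
      f.continuous.integrable_of_hasCompactSupport (HasCompactSupport.of_compactSpace _)
    rw [dist_eq_norm, ← integral_sub (hi f) (hi g), NNReal.coe_one, one_mul]
    have hle : ∀ x, ‖f x - g x‖ ≤ dist f g := fun x => by
      rw [← dist_eq_norm]
      exact ContinuousMap.dist_apply_le_dist x
    exact (norm_integral_le_of_norm_le_const (μ := (μ : Measure Ω))
      (Eventually.of_forall hle)).trans (by simp)
  have h' : (fun f : C(Ω, ℝ) => ∫ x, f x ∂(μ : Measure Ω)) = fun f => ∫ x, f x ∂(ν : Measure Ω) :=
    (TopologicalSpace.denseRange_denseSeq C(Ω, ℝ)).equalizer (hc μ) (hc ν) (funext h)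
  apply ProbabilityMeasure.toMeasure_injective
  refine ext_of_forall_integral_eq_of_IsFiniteMeasure fun f => ?_
  exact congrFun h' f.toContinuousMap

theorem exists_continuous_strictConvex_probabilityMeasure (Ω : Type*) [MetricSpace Ω]
    [CompactSpace Ω] [MeasurableSpace Ω] [BorelSpace Ω] :
    ∃ Φ : ProbabilityMeasure Ω → ℝ, Continuous Φ ∧
      ∀ (μ ν ξ : ProbabilityMeasure Ω) (p q : ℝ), 0 < p → 0 < q → p + q = 1 →
        (∀ f : C(Ω, ℝ), ∫ x, f x ∂ξ = p * ∫ x, f x ∂μ + q * ∫ x, f x ∂ν) →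
        Φ μ ≤ Φ ξ → Φ ν ≤ Φ ξ → μ = ν := by
  obtain ⟨f, hf⟩ := exists_seq_continuousMap_separating_measures Ω
  set c : ℕ → ProbabilityMeasure Ω → ℝ := fun n μ => (∫ x, f n x ∂(μ : Measure Ω)) / (1 + ‖f n‖)
  have hc : ∀ n, Continuous (c n) := fun n =>
    (ProbabilityMeasure.continuous_integral_continuousMap (f n)).div_const _
  have hc1 : ∀ n μ, |c n μ| ≤ 1 := by
    intro n μ
    have h0 : 0 < 1 + ‖f n‖ := by positivity
    rw [abs_div, abs_of_pos h0, div_le_one h0, ← Real.norm_eq_abs]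
    refine (norm_integral_le_of_norm_le_const (C := ‖f n‖)
      (Eventually.of_forall fun x => (f n).norm_coe_le_norm x)).trans ?_
    simp
  have hb : ∀ n μ, ‖(1 / 2 : ℝ) ^ n * c n μ ^ 2‖ ≤ (1 / 2 : ℝ) ^ n := by
    intro n μ
    rw [norm_mul, norm_pow, norm_pow, Real.norm_eq_abs (c n μ), Real.norm_eq_abs,
      abs_of_pos (by positivity)]
    exact mul_le_of_le_one_right (by positivity) (pow_le_one₀ (abs_nonneg _) (hc1 n μ))
  have hs : ∀ μ, Summable fun n => (1 / 2 : ℝ) ^ n * c n μ ^ 2 := fun μ =>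
    Summable.of_norm_bounded summable_geometric_two fun n => hb n μ
  refine ⟨fun μ => ∑' n, (1 / 2 : ℝ) ^ n * c n μ ^ 2,
    continuous_tsum (fun n => by have := hc n; fun_prop) summable_geometric_two hb, ?_⟩
  intro μ ν ξ p q hp hq hpq hξ hμ hν
  apply hf
  have hcξ : ∀ n, c n ξ = p * c n μ + q * c n ν := by
    intro n
    simp only [c, hξ]
    ring
  have hsum : HasSum (fun n => (p * q) * ((1 / 2 : ℝ) ^ n * (c n μ - c n ν) ^ 2))
      (p * (∑' n, (1 / 2 : ℝ) ^ n * c n μ ^ 2) + q * (∑' n, (1 / 2 : ℝ) ^ n * c n ν ^ 2)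
        - ∑' n, (1 / 2 : ℝ) ^ n * c n ξ ^ 2) := by
    refine ((((hs μ).hasSum.mul_left p).add ((hs ν).hasSum.mul_left q)).sub
      (hs ξ).hasSum).congr_fun ?_
    intro n
    rw [hcξ, show q = 1 - p by linarith]
    ring
  have h0 : ∀ n, 0 ≤ (p * q) * ((1 / 2 : ℝ) ^ n * (c n μ - c n ν) ^ 2) := fun n => by positivity
  have hle : p * (∑' n, (1 / 2 : ℝ) ^ n * c n μ ^ 2) + q * (∑' n, (1 / 2 : ℝ) ^ n * c n ν ^ 2)
        - ∑' n, (1 / 2 : ℝ) ^ n * c n ξ ^ 2 ≤ 0 := by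
    have e : ∑' n, (1 / 2 : ℝ) ^ n * c n ξ ^ 2
      = p * ∑' n, (1 / 2 : ℝ) ^ n * c n ξ ^ 2 + q * ∑' n, (1 / 2 : ℝ) ^ n * c n ξ ^ 2 := by
      rw [← add_mul, hpq, one_mul]
    rw [e]
    have := mul_le_mul_of_nonneg_left hμ hp.le
    have := mul_le_mul_of_nonneg_left hν hq.le
    linarith
  rw [le_antisymm hle (hsum.nonneg h0), hasSum_zero_iff_of_nonneg h0] at hsum
  intro n
  have h1 : c n μ - c n ν = 0 := by
    have := congrFun hsum n
    simpa [hp.ne', hq.ne'] using this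
  have h2 : (1 + ‖f n‖) ≠ 0 := by positivity
  exact (div_left_inj' h2).1 (sub_eq_zero.1 h1)

theorem map_cond_eq_of_preimage_eq {Ω : Type*} [MeasurableSpace Ω] {T : Ω → Ω}
    (hT : Measurable T) {μ : Measure Ω} (hμ : μ.map T = μ) {B : Set Ω} (hB : MeasurableSet B)
    (hTB : T ⁻¹' B = B) : (μ[|B]).map T = μ[|B] := by
  ext A hA
  rw [Measure.map_apply hT hA, cond_apply hB, cond_apply hB]
  congr 1
  conv_lhs => rw [← hTB, ← preimage_inter, ← Measure.map_apply hT (hB.inter hA), hμ]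

theorem integral_eq_cond_add_cond_compl {Ω : Type*} [MeasurableSpace Ω] (μ : Measure Ω)
    [IsProbabilityMeasure μ] {B : Set Ω} (hB : MeasurableSet B) (h0 : μ B ≠ 0) (h1 : μ Bᶜ ≠ 0)
    {f : Ω → ℝ} (hf : Integrable f μ) :
    ∫ x, f x ∂μ = μ.real B * ∫ x, f x ∂μ[|B] + μ.real Bᶜ * ∫ x, f x ∂μ[|Bᶜ] := by
  have key : ∀ A : Set Ω, μ A ≠ 0 → μ.real A * ∫ x, f x ∂μ[|A] = ∫ x in A, f x ∂μ := by
    intro A hA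
    have hA' : μ.real A ≠ 0 := by simp [measureReal_eq_zero_iff, hA]
    rw [ProbabilityTheory.cond, integral_smul_measure, ENNReal.toReal_inv, smul_eq_mul]
    exact mul_inv_cancel_left₀ hA' _
  rw [key B h0, key Bᶜ h1, integral_add_compl hB hf]

/-- An invariant measure can be replaced by an ergodic one without decreasing the mass of a given
closed set. -/
theorem exists_ergodic_measure_ge_of_isClosed {Ω ι : Type*} [MetricSpace Ω] [CompactSpace Ω]
    [MeasurableSpace Ω] [BorelSpace Ω] {T : ι → Ω → Ω} (hT : ∀ i, Continuous (T i))
    {F : Set Ω} (hF : IsClosed F) (m : Measure Ω) [IsProbabilityMeasure m]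
    (hm : ∀ i, m.map (T i) = m) :
    ∃ μ : Measure Ω, IsProbabilityMeasure μ ∧ (∀ i, μ.map (T i) = μ) ∧
      (∀ B : Set Ω, MeasurableSet B → (∀ i, T i ⁻¹' B = B) → μ B = 0 ∨ μ B = 1) ∧
      m F ≤ μ F := by
  obtain ⟨Φ, hΦc, hΦ⟩ := exists_continuous_strictConvex_probabilityMeasure Ω
  set I : Set (ProbabilityMeasure Ω) := {μ | ∀ i, (μ : Measure Ω).map (T i) = μ} with hI
  have hIc : IsClosed I := by
    have : I = ⋂ i, {μ : ProbabilityMeasure Ω | μ.map (hT i).measurable.aemeasurable = μ} := by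
      ext μ
      simp only [hI, mem_ofPred_eq, mem_iInter]
      refine forall_congr' fun i => ⟨fun h => Subtype.ext h, fun h => ?_⟩
      exact congrArg (fun ν : ProbabilityMeasure Ω => (ν : Measure Ω)) h
    rw [this]
    exact isClosed_iInter fun i =>
      isClosed_eq (ProbabilityMeasure.continuous_map (hT i)) continuous_id
  have husc : UpperSemicontinuous fun μ : ProbabilityMeasure Ω => (μ : Measure Ω) F := by
    intro μ y hy
    exact eventually_lt_of_limsup_lt
      ((ProbabilityMeasure.limsup_measure_closed_le_of_tendsto tendsto_id hF).trans_lt hy)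
  obtain ⟨μ₀, hμ₀, hmax₀⟩ := UpperSemicontinuousOn.exists_isMaxOn
    (s := I) ⟨⟨m, inferInstance⟩, hm⟩ hIc.isCompact (husc.upperSemicontinuousOn I)
  have hKc : IsClosed (I ∩ {μ : ProbabilityMeasure Ω | (μ₀ : Measure Ω) F ≤ (μ : Measure Ω) F}) :=
    hIc.inter (husc.isClosed_preimage _)
  obtain ⟨μ, ⟨hμI, hμF⟩, hmax⟩ := hKc.isCompact.exists_isMaxOn
    ⟨μ₀, hμ₀, le_refl ((μ₀ : Measure Ω) F)⟩ hΦc.continuousOn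
  refine ⟨μ, inferInstance, hμI, fun B hB hTB => ?_, (hmax₀ (a := ⟨m, inferInstance⟩) hm).trans hμF⟩
  by_contra! hcon
  obtain ⟨h0, h1⟩ := hcon
  have h1' : (μ : Measure Ω) Bᶜ ≠ 0 := fun h => h1 ((prob_compl_eq_zero_iff hB).1 h)
  have hTB' : ∀ i, T i ⁻¹' Bᶜ = Bᶜ := fun i => by rw [preimage_compl, hTB]
  have P1 := cond_isProbabilityMeasure (μ := (μ : Measure Ω)) h0
  have P2 := cond_isProbabilityMeasure (μ := (μ : Measure Ω)) h1'
  set μ₁ : ProbabilityMeasure Ω := ⟨(μ : Measure Ω)[|B], P1⟩ with hμ₁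
  set μ₂ : ProbabilityMeasure Ω := ⟨(μ : Measure Ω)[|Bᶜ], P2⟩ with hμ₂
  have hI1 : μ₁ ∈ I := fun i =>
    map_cond_eq_of_preimage_eq (hT i).measurable (hμI i) hB (hTB i)
  have hI2 : μ₂ ∈ I := fun i =>
    map_cond_eq_of_preimage_eq (hT i).measurable (hμI i) hB.compl (hTB' i)
  have hp : 0 < (μ : Measure Ω).real B :=
    measureReal_nonneg.lt_of_ne' (by simp [h0])
  have hq : 0 < (μ : Measure Ω).real Bᶜ :=
    measureReal_nonneg.lt_of_ne' (by simp [h1'])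
  have hpq : (μ : Measure Ω).real B + (μ : Measure Ω).real Bᶜ = 1 := by
    rw [measureReal_add_measureReal_compl hB, probReal_univ]
  have hdec : ∀ f : Ω → ℝ, Integrable f (μ : Measure Ω) → ∫ x, f x ∂(μ : Measure Ω) =
      (μ : Measure Ω).real B * ∫ x, f x ∂(μ₁ : Measure Ω)
        + (μ : Measure Ω).real Bᶜ * ∫ x, f x ∂(μ₂ : Measure Ω) := fun f hf =>
    integral_eq_cond_add_cond_compl _ hB h0 h1' hf
  have hmassle : ∀ ν ∈ I, (ν : Measure Ω).real F ≤ (μ : Measure Ω).real F := fun ν hν =>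
    ENNReal.toReal_mono (measure_ne_top _ _) ((hmax₀ hν).trans hμF)
  have hmass : (μ : Measure Ω).real F = (μ : Measure Ω).real B * (μ₁ : Measure Ω).real F
      + (μ : Measure Ω).real Bᶜ * (μ₂ : Measure Ω).real F := by
    simpa [integral_indicator_one hF.measurableSet] using
      hdec (F.indicator 1) ((integrable_const 1).indicator hF.measurableSet)
  have hle1 := hmassle μ₁ hI1
  have hle2 := hmassle μ₂ hI2
  have hK : ∀ ν ∈ I, (μ : Measure Ω).real F ≤ (ν : Measure Ω).real F → Φ ν ≤ Φ μ :=
    fun ν hν h => hmax ⟨hν, hμF.trans <|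
      (ENNReal.toReal_le_toReal (measure_ne_top _ _) (measure_ne_top _ _)).1 h⟩
  have hge1 : (μ : Measure Ω).real F ≤ (μ₁ : Measure Ω).real F := by
    refine le_of_mul_le_mul_left ?_ hp
    have := mul_le_mul_of_nonneg_left hle2 hq.le
    linear_combination this + hmass + (μ : Measure Ω).real F * hpq
  have hge2 : (μ : Measure Ω).real F ≤ (μ₂ : Measure Ω).real F := by
    refine le_of_mul_le_mul_left ?_ hq
    have := mul_le_mul_of_nonneg_left hle1 hp.le
    linear_combination this + hmass + (μ : Measure Ω).real F * hpq
  have heq : μ₁ = μ₂ :=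
    hΦ μ₁ μ₂ μ _ _ hp hq hpq (fun f => hdec f
      (f.continuous.integrable_of_hasCompactSupport (HasCompactSupport.of_compactSpace _)))
      (hK _ hI1 hge1) (hK _ hI2 hge2)
  have e1 : (μ₁ : Measure Ω) B = 1 := cond_apply_self h0 (measure_ne_top _ _)
  have e2 : (μ₂ : Measure Ω) B = 0 := by
    simp [hμ₂, cond_apply hB.compl]
  rw [heq, e2] at e1
  exact zero_ne_one e1

theorem integral_comp_sub_eq_zero_of_bounded {Ω : Type*} [MeasurableSpace Ω] {μ : Measure Ω}
    [IsFiniteMeasure μ] {T : Ω → Ω} (hT : MeasurePreserving T μ μ) {g : Ω → ℝ} (hg : Measurable g)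
    {M : ℝ} (hM : ∀ᵐ x ∂μ, |g (T x) - g x| ≤ M) : ∫ x, (g (T x) - g x) ∂μ = 0 := by
  set G : ℕ → Ω → ℝ := fun n x => max (-(n : ℝ)) (min (g x) n) with hG
  have hGm : ∀ n, Measurable (G n) := fun n => by fun_prop
  have hGb : ∀ n x, ‖G n x‖ ≤ n := by
    intro n x
    have : (0 : ℝ) ≤ n := n.cast_nonneg
    rw [Real.norm_eq_abs, abs_le]
    exact ⟨le_max_left _ _, max_le (by linarith) (min_le_right _ _)⟩
  have hGi : ∀ n, Integrable (G n) μ := fun n =>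
    Integrable.of_bound (hGm n).aestronglyMeasurable n (Eventually.of_forall (hGb n))
  have hz : ∀ n, ∫ x, (G n (T x) - G n x) ∂μ = 0 := by
    intro n
    have hi : Integrable (fun x => G n (T x)) μ := hT.integrable_comp_of_integrable (hGi n)
    have hmap : ∫ x, G n (T x) ∂μ = ∫ x, G n x ∂μ := by
      conv_rhs => rw [← hT.map_eq]
      rw [integral_map hT.measurable.aemeasurable (hGm n).aestronglyMeasurable]
    rw [integral_sub hi (hGi n), hmap, sub_self]
  have hev : ∀ x, ∀ᶠ n in atTop, G n x = g x := by
    intro x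
    filter_upwards [eventually_ge_atTop ⌈|g x|⌉₊] with n hn
    have h1 : |g x| ≤ n := Nat.ceil_le.1 hn
    rw [abs_le] at h1
    simp only [hG]
    rw [min_eq_left h1.2, max_eq_right h1.1]
  have hlim : Tendsto (fun n => ∫ x, (G n (T x) - G n x) ∂μ) atTop
      (𝓝 (∫ x, (g (T x) - g x) ∂μ)) := by
    refine tendsto_integral_of_dominated_convergence (fun _ => M)
      (fun n => (((hGm n).comp hT.measurable).sub (hGm n)).aestronglyMeasurable)
      (integrable_const M) (fun n => ?_) (Eventually.of_forall fun x => ?_)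
    · filter_upwards [hM] with x hx
      refine le_trans ?_ hx
      rw [Real.norm_eq_abs]
      simp only [hG]
      refine (abs_max_sub_max_le_max _ _ _ _).trans (max_le (by simp) ?_)
      exact (abs_min_sub_min_le_max _ _ _ _).trans (max_le le_rfl (by simp))
    · apply tendsto_const_nhds.congr'
      filter_upwards [hev x, hev (T x)] with n h1 h2
      rw [h1, h2]
  simp only [hz] at hlim
  exact tendsto_nhds_unique hlim tendsto_const_nhds

section Cocycle

variable {Ω : Type*} {σ : ℝ → Ω → Ω} {a : Ω → ℝ}

theorem abs_orbitIntegral_le {M : ℝ} (hM : ∀ ω, |a ω| ≤ M) (t : ℝ) (ω : Ω) :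
    |∫ s in (0:ℝ)..t, a (σ s ω)| ≤ M * |t| := by
  simpa using intervalIntegral.norm_integral_le_of_norm_le_const (a := 0) (b := t)
    (f := fun s => a (σ s ω)) (C := M) fun s _ => hM _

variable [MetricSpace Ω]

theorem continuous_orbitIntegral (hσcont : Continuous fun p : ℝ × Ω => σ p.1 p.2)
    (ha : Continuous a) (t : ℝ) : Continuous fun ω => ∫ s in (0:ℝ)..t, a (σ s ω) := by
  have : Continuous (Function.uncurry fun (ω : Ω) (s : ℝ) => a (σ s ω)) :=
    ha.comp (hσcont.comp continuous_swap)
  fun_prop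

theorem orbitIntegral_add (hσcont : Continuous fun p : ℝ × Ω => σ p.1 p.2)
    (hσadd : ∀ s t ω, σ (s + t) ω = σ s (σ t ω)) (ha : Continuous a) (s t : ℝ) (ω : Ω) :
    ∫ r in (0:ℝ)..s + t, a (σ r ω) =
      (∫ r in (0:ℝ)..t, a (σ r ω)) + ∫ r in (0:ℝ)..s, a (σ r (σ t ω)) := by
  have hc : Continuous fun r => a (σ r ω) := 
    ha.comp (hσcont.comp (by fun_prop : Continuous fun r : ℝ => (r, ω)))
  simp_rw [← hσadd]
  rw [intervalIntegral.integral_comp_add_right (fun r => a (σ r ω)), zero_add,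
    intervalIntegral.integral_add_adjacent_intervals (hc.intervalIntegrable _ _)
      (hc.intervalIntegrable _ _)]

variable [CompactSpace Ω] [MeasurableSpace Ω] [BorelSpace Ω]

theorem integral_orbitIntegral_one (hσcont : Continuous fun p : ℝ × Ω => σ p.1 p.2)
    (ha : Continuous a) (μ : Measure Ω) [IsProbabilityMeasure μ]
    (hμ : ∀ t, Measure.map (σ t) μ = μ) :
    ∫ ω, (∫ s in (0:ℝ)..1, a (σ s ω)) ∂μ = ∫ ω, a ω ∂μ := by
  have hc : Continuous (Function.uncurry fun (s : ℝ) (ω : Ω) => a (σ s ω)) := ha.comp hσcont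
  have hσt : ∀ t, Continuous (σ t) := fun t =>
    hσcont.comp (by fun_prop : Continuous fun ω : Ω => (t, ω))
  obtain ⟨M, hM⟩ := isCompact_univ.exists_bound_of_continuousOn ha.continuousOn
  have hi : Integrable (Function.uncurry fun (s : ℝ) (ω : Ω) => a (σ s ω))
      ((volume.restrict (uIoc 0 1)).prod μ) := by
    have : IsFiniteMeasure ((volume : Measure ℝ).restrict (uIoc 0 1)) := by
      rw [uIoc_of_le zero_le_one]
      infer_instance
    exact Integrable.of_bound hc.aestronglyMeasurable M
      (Eventually.of_forall fun p => hM _ (mem_univ _))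
  rw [← intervalIntegral_integral_swap hi]
  have : ∀ s, ∫ ω, a (σ s ω) ∂μ = ∫ ω, a ω ∂μ := by
    intro s
    conv_rhs => rw [← hμ s]
    rw [integral_map (hσt s).measurable.aemeasurable ha.aestronglyMeasurable]
  simp [this]

/-- If the forward and backward orbit integrals are bounded above a.e., then the mean vanishes. -/
theorem integral_eq_zero_of_ae_orbitIntegral_le (hσcont : Continuous fun p : ℝ × Ω => σ p.1 p.2)
    (hσadd : ∀ s t ω, σ (s + t) ω = σ s (σ t ω)) (ha : Continuous a)
    (μ : Measure Ω) [IsProbabilityMeasure μ] (hμ : ∀ t, Measure.map (σ t) μ = μ)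
    (hb : ∀ᵐ ω ∂μ, ∃ C : ℝ, ∀ t : ℝ, (∫ s in (0:ℝ)..t, a (σ s ω)) ≤ C) :
    ∫ ω, a ω ∂μ = 0 := by
  have hσt : ∀ t, Continuous (σ t) := fun t =>
    hσcont.comp (by fun_prop : Continuous fun ω : Ω => (t, ω))
  have hT : MeasurePreserving (σ 1) μ μ := ⟨(hσt 1).measurable, hμ 1⟩
  obtain ⟨M, hM⟩ := isCompact_univ.exists_bound_of_continuousOn ha.continuousOn
  rw [← integral_orbitIntegral_one hσcont ha μ hμ]
  set F : ℝ → Ω → ℝ := fun t ω => ∫ s in (0:ℝ)..t, a (σ s ω) with hF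
  have hadd : ∀ s t ω, F (s + t) ω = F t ω + F s (σ t ω) := orbitIntegral_add hσcont hσadd ha
  set g : Ω → ℝ := fun ω => ⨆ n : ℤ, F n ω with hg
  have hgm : Measurable g :=
    Measurable.iSup fun n => (continuous_orbitIntegral hσcont ha n).measurable
  have key : ∀ᵐ ω ∂μ, g (σ 1 ω) - g ω = - F 1 ω := by
    filter_upwards [hb] with ω ⟨C, hC⟩
    have h1 : BddAbove (range fun n : ℤ => F n ω) := ⟨C, by rintro _ ⟨n, rfl⟩; exact hC n⟩
    have h2 : ∀ n : ℤ, F n (σ 1 ω) = F ((n + 1 : ℤ) : ℝ) ω - F 1 ω := by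
      intro n
      rw [Int.cast_add, Int.cast_one, hadd]
      ring
    have h3 : BddAbove (range fun n : ℤ => F n (σ 1 ω)) := by
      refine ⟨C - F 1 ω, ?_⟩
      rintro _ ⟨n, rfl⟩
      simp only [h2]
      exact sub_le_sub_right (hC _) _
    have h4 : g (σ 1 ω) ≤ g ω - F 1 ω := ciSup_le fun n => by
      rw [h2]
      exact sub_le_sub_right (le_ciSup h1 (n + 1)) _
    have h5 : g ω ≤ g (σ 1 ω) + F 1 ω := ciSup_le fun n => by
      have := le_ciSup h3 (n - 1)
      simp only [h2, sub_add_cancel] at this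
      simp only [hg, h2]
      linarith
    linarith
  have := integral_comp_sub_eq_zero_of_bounded hT hgm (M := M) (by
    filter_upwards [key] with ω hω
    rw [hω, abs_neg]
    simpa using abs_orbitIntegral_le (σ := σ) (a := a) (fun ω => hM ω (mem_univ _)) 1 ω)
  rw [integral_congr_ae key, integral_neg, neg_eq_zero] at this
  exact this

/-- If the mean vanishes, backward boundedness a.e. of the orbit integrals implies boundedness on
the whole orbit a.e. -/
theorem ae_orbitIntegral_le_of_ae_nonpos (hσcont : Continuous fun p : ℝ × Ω => σ p.1 p.2)
    (hσ0 : ∀ ω, σ 0 ω = ω)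
    (hσadd : ∀ s t ω, σ (s + t) ω = σ s (σ t ω)) (ha : Continuous a)
    (μ : Measure Ω) [IsProbabilityMeasure μ] (hμ : ∀ t, Measure.map (σ t) μ = μ)
    (hint : ∫ ω, a ω ∂μ = 0)
    (hb : ∀ᵐ ω ∂μ, ∃ C : ℝ, ∀ t ≤ (0:ℝ), (∫ s in (0:ℝ)..t, a (σ s ω)) ≤ C) :
    ∀ᵐ ω ∂μ, ∃ C : ℝ, ∀ t : ℝ, (∫ s in (0:ℝ)..t, a (σ s ω)) ≤ C := by
  have hσt : ∀ t, Continuous (σ t) := fun t =>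
    hσcont.comp (by fun_prop : Continuous fun ω : Ω => (t, ω))
  have hmp : ∀ t, MeasurePreserving (σ t) μ μ := fun t => ⟨(hσt t).measurable, hμ t⟩
  obtain ⟨M, hM⟩ := isCompact_univ.exists_bound_of_continuousOn ha.continuousOn
  have hM' : ∀ t ω, |∫ s in (0:ℝ)..t, a (σ s ω)| ≤ M * |t| :=
    abs_orbitIntegral_le fun ω => hM ω (mem_univ _)
  rw [← integral_orbitIntegral_one hσcont ha μ hμ] at hint
  have hFc : ∀ t, Continuous fun ω => ∫ s in (0:ℝ)..t, a (σ s ω) :=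
    continuous_orbitIntegral hσcont ha
  have hadd := orbitIntegral_add hσcont hσadd ha
  set F : ℝ → Ω → ℝ := fun t ω => ∫ s in (0:ℝ)..t, a (σ s ω) with hF
  replace hadd : ∀ s t ω, F (s + t) ω = F t ω + F s (σ t ω) := hadd
  replace hM' : ∀ t ω, |F t ω| ≤ M * |t| := hM'
  replace hFc : ∀ t, Continuous (F t) := hFc
  have hM1 : ∀ ω, |F 1 ω| ≤ M := fun ω => by simpa using hM' 1 ω
  set g : Ω → ℝ := fun ω => ⨆ n : ℕ, F (-(n : ℝ)) ω with hg
  have hgm : Measurable g := Measurable.iSup fun n => (hFc _).measurable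
  have hbdd : ∀ᵐ ω ∂μ, BddAbove (range fun n : ℕ => F (-(n : ℝ)) ω) := by
    filter_upwards [hb] with ω ⟨C, hC⟩
    exact ⟨C, by rintro _ ⟨n, rfl⟩; exact hC _ (by simp)⟩
  have hstep : ∀ (n : ℕ) ω, F (-(n : ℝ)) ω = F 1 ω + F (-((n + 1 : ℕ) : ℝ)) (σ 1 ω) := by
    intro n ω
    rw [← hadd]
    congr 1
    push_cast
    ring
  have hstep' : ∀ (n : ℕ) ω, F (-(n : ℝ)) (σ 1 ω) ≤ F (-(n : ℝ)) ω + 2 * M := by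
    intro n ω
    have e1 := hadd (-(n : ℝ)) 1 ω
    have e2 := hadd 1 (-(n : ℝ)) ω
    rw [add_comm] at e2
    have h1 := abs_le.1 (hM1 ω)
    have h2 := abs_le.1 (hM1 (σ (-(n : ℝ)) ω))
    linarith
  have hlow : ∀ᵐ ω ∂μ, 0 ≤ F 1 ω + (g (σ 1 ω) - g ω) ∧ |g (σ 1 ω) - g ω| ≤ 2 * M := by
    filter_upwards [hbdd, (hmp 1).quasiMeasurePreserving.ae hbdd] with ω h1 h2
    have h3 : g ω ≤ F 1 ω + g (σ 1 ω) := ciSup_le fun n => by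
      rw [hstep]
      exact add_le_add_right (le_ciSup h2 (n + 1)) _
    have h4 : g (σ 1 ω) ≤ g ω + 2 * M := ciSup_le fun n =>
      (hstep' n ω).trans (add_le_add_left (le_ciSup h1 n) _)
    have h5 := abs_le.1 (hM1 ω)
    exact ⟨by linarith, abs_le.2 ⟨by linarith, by linarith⟩⟩
  have hgi : Integrable (fun ω => g (σ 1 ω) - g ω) μ :=
    Integrable.of_bound ((hgm.comp (hσt 1).measurable).sub hgm).aestronglyMeasurable (2 * M)
      (hlow.mono fun ω h => h.2)
  have hFi : Integrable (F 1) μ :=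
    Integrable.of_bound (hFc 1).aestronglyMeasurable M (Eventually.of_forall hM1)
  have hzero : ∀ᵐ ω ∂μ, F 1 ω + (g (σ 1 ω) - g ω) = 0 := by
    refine (integral_eq_zero_iff_of_nonneg_ae (hlow.mono fun ω h => h.1) (hFi.add hgi)).1 ?_
    rw [integral_add hFi hgi, hint, integral_comp_sub_eq_zero_of_bounded (hmp 1) hgm
      (hlow.mono fun ω h => h.2), add_zero]
  have hall : ∀ᵐ ω ∂μ, ∀ n : ℕ, F 1 (σ n ω) + (g (σ 1 (σ n ω)) - g (σ n ω)) = 0 ∧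
      BddAbove (range fun k : ℕ => F (-(k : ℝ)) (σ n ω)) :=
    ae_all_iff.2 fun n => (hmp n).quasiMeasurePreserving.ae (hzero.and hbdd)
  filter_upwards [hall, hb] with ω hω ⟨C, hC⟩
  have hF0 : ∀ ω, F 0 ω = 0 := fun ω => by simp [hF]
  have hind : ∀ n : ℕ, F n ω = g ω - g (σ n ω) := by
    intro n
    induction n with
    | zero => simp [hF0, hσ0]
    | succ n ih =>
      have h1 := (hω n).1
      rw [← hσadd] at h1
      push_cast
      rw [add_comm (n : ℝ) 1, hadd, ih]
      linarith
  have hnat : ∀ n : ℕ, F n ω ≤ g ω := by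
    intro n
    have h1 := le_ciSup (hω n).2 0
    simp only [Nat.cast_zero, neg_zero, hF0] at h1
    rw [hind]
    exact sub_le_self _ h1
  refine ⟨max C (g ω + M), fun t => ?_⟩
  rcases le_total t 0 with ht | ht
  · exact (hC t ht).trans (le_max_left _ _)
  · refine le_trans ?_ (le_max_right _ _)
    have h1 := hadd (t - ⌊t⌋₊) ⌊t⌋₊ ω
    rw [sub_add_cancel] at h1
    have h2 := (abs_le.1 (hM' (t - ⌊t⌋₊) (σ ⌊t⌋₊ ω))).2
    have hM0 : 0 ≤ M := (abs_nonneg _).trans (hM1 ω)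
    have h3 : |t - ⌊t⌋₊| ≤ 1 := by
      have := Nat.floor_le ht
      have := Nat.lt_floor_add_one t
      rw [abs_le]
      constructor <;> linarith
    have h4 := mul_le_of_le_one_right hM0 h3
    have h5 := hnat ⌊t⌋₊
    change F t ω ≤ _
    linarith

end Cocycle

end

/-- For a minimal non-periodic continuous flow on a nonempty compact metric
space, if `a ∈ R_m(Ω)` for a `σ`-invariant Borel probability measure `m`, then there exists
a `σ`-ergodic Borel probability measure `m̃` with `a ∈ R_{m̃}(Ω)`. -/
theorem stmt5 {Ω : Type*} [MetricSpace Ω] [CompactSpace Ω] [Nonempty Ω]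
    [MeasurableSpace Ω] [BorelSpace Ω]
    (σ : ℝ → Ω → Ω)
    (hσcont : Continuous fun p : ℝ × Ω => σ p.1 p.2)
    (hσ0 : ∀ ω, σ 0 ω = ω)
    (hσadd : ∀ s t ω, σ (s + t) ω = σ s (σ t ω))
    (hmin : ∀ ω : Ω, Dense (Set.range fun t => σ t ω))
    (hnp : ∀ ω : Ω, Function.Injective fun t : ℝ => σ t ω)
    (m : Measure Ω) [IsProbabilityMeasure m]
    (hminv : ∀ t, Measure.map (σ t) m = m)
    (a : Ω → ℝ) (ha : Continuous a)
    (hint : ∫ ω, a ω ∂m = 0)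
    (hnoprim : ¬ ∃ h : Ω → ℝ, Continuous h ∧
      ∀ ω t, h (σ t ω) - h ω = ∫ s in (0:ℝ)..t, a (σ s ω))
    (hbdd : ∀ᵐ ω ∂m, ∃ C : ℝ, ∀ t ≤ (0:ℝ), (∫ s in (0:ℝ)..t, a (σ s ω)) ≤ C) :
    ∃ m' : Measure Ω, IsProbabilityMeasure m' ∧
      (∀ t, Measure.map (σ t) m' = m') ∧
      (∀ B : Set Ω, MeasurableSet B → (∀ t, σ t ⁻¹' B = B) → m' B = 0 ∨ m' B = 1) ∧
      ∫ ω, a ω ∂m' = 0 ∧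
      (∀ᵐ ω ∂m', ∃ C : ℝ, ∀ t ≤ (0:ℝ), (∫ s in (0:ℝ)..t, a (σ s ω)) ≤ C) := by
  have hσt : ∀ t, Continuous (σ t) := fun t =>
    hσcont.comp (by fun_prop : Continuous fun ω : Ω => (t, ω))
  have hb := ae_orbitIntegral_le_of_ae_nonpos hσcont hσ0 hσadd ha m hminv hint hbdd
  set E : ℕ → Set Ω := fun k => {ω | ∀ t : ℝ, (∫ s in (0:ℝ)..t, a (σ s ω)) ≤ k} with hE
  have hEc : ∀ k, IsClosed (E k) := fun k => by
    have : E k = ⋂ t : ℝ, {ω | (∫ s in (0:ℝ)..t, a (σ s ω)) ≤ k} := by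
      ext ω
      simp [hE]
    rw [this]
    exact isClosed_iInter fun t =>
      isClosed_le (continuous_orbitIntegral hσcont ha t) continuous_const
  have hEmem : ∀ ω, ω ∈ ⋃ k, E k ↔ ∃ C : ℝ, ∀ t : ℝ, (∫ s in (0:ℝ)..t, a (σ s ω)) ≤ C := by
    intro ω
    simp only [hE, Set.mem_iUnion, Set.mem_ofPred_eq]
    refine ⟨fun ⟨k, hk⟩ => ⟨k, hk⟩, fun ⟨C, hC⟩ => ⟨⌈C⌉₊, fun t => (hC t).trans (Nat.le_ceil C)⟩⟩
  have hEinv : ∀ t, σ t ⁻¹' (⋃ k, E k) = ⋃ k, E k := by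
    have hsub : ∀ t ω, ω ∈ ⋃ k, E k → σ t ω ∈ ⋃ k, E k := by
      intro t ω hω
      rw [hEmem] at hω ⊢
      obtain ⟨C, hC⟩ := hω
      refine ⟨C - ∫ s in (0:ℝ)..t, a (σ s ω), fun s => ?_⟩
      have h1 := orbitIntegral_add hσcont hσadd ha s t ω
      have h2 := hC (s + t)
      linarith
    intro t
    ext ω
    refine ⟨fun h => ?_, hsub t ω⟩
    have := hsub (-t) _ h
    rwa [← hσadd, neg_add_cancel, hσ0] at this
  obtain ⟨k, hk⟩ : ∃ k, m (E k) ≠ 0 := by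
    by_contra! hcon
    have h0 : m (⋃ k, E k) = 0 := measure_iUnion_null hcon
    have h1 : ∀ᵐ ω ∂m, False := by
      filter_upwards [hb, measure_eq_zero_iff_ae_notMem.1 h0] with ω h1 h2
      exact h2 ((hEmem ω).2 h1)
    exact h1.exists.elim fun _ h => h
  obtain ⟨μ, hμ, hμinv, hμerg, hle⟩ :=
    exists_ergodic_measure_ge_of_isClosed hσt (hEc k) m hminv
  have hpos : μ (⋃ k, E k) ≠ 0 := fun h =>
    hk (le_antisymm (hle.trans ((measure_mono (Set.subset_iUnion E k)).trans h.le)) zero_le)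
  have hEm : MeasurableSet (⋃ k, E k) := MeasurableSet.iUnion fun k => (hEc k).measurableSet
  have hfull : ∀ᵐ ω ∂μ, ∃ C : ℝ, ∀ t : ℝ, (∫ s in (0:ℝ)..t, a (σ s ω)) ≤ C := by
    have h1 := (prob_compl_eq_zero_iff hEm).2 ((hμerg _ hEm hEinv).resolve_left hpos)
    filter_upwards [measure_eq_zero_iff_ae_notMem.1 h1] with ω hω
    exact (hEmem ω).1 (not_not.1 hω)
  exact ⟨μ, hμ, hμinv, hμerg,
    integral_eq_zero_of_ae_orbitIntegral_le hσcont hσadd ha μ hμinv hfull,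
    hfull.mono fun ω ⟨C, hC⟩ => ⟨C, fun t _ => hC t⟩⟩
end

section
/- Let σ be a minimal continuous flow on a nonempty compact metric space Ω, let m be a σ-ergodic Borel probability measure on Ω, and let a : Ω → ℝ be continuous with ∫_Ω a dm = 0. Define Ω^a := { ω ∈ Ω : sup_{t ∈ ℝ} ∫_0^t a(ω·s) ds < ∞, inf_{t ≤ 0} ∫_0^t a(ω·s) ds = −∞, and inf_{t ≥ 0} ∫_0^t a(ω·s) ds = −∞ }. Then a ∈ R_m(Ω) if and only if Ω^a is σ-invariant (ω ∈ Ω^a implies ω·t ∈ Ω^a for all t ∈ ℝ) and m(Ω^a) = 1. -/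
open MeasureTheory Filter Topology Set

/-- The additive cocycle `(t, ω) ↦ ∫₀ᵗ a(ω·s) ds` of `a` along `σ`. -/
noncomputable def flowCocycle {Ω : Type*} (σ : ℝ → Ω → Ω) (a : Ω → ℝ) (t : ℝ) (ω : Ω) : ℝ :=
  ∫ s in (0:ℝ)..t, a (σ s ω)

lemma flowCocycle_zero {Ω : Type*} (σ : ℝ → Ω → Ω) (a : Ω → ℝ) (ω : Ω) :
    flowCocycle σ a 0 ω = 0 := by
  simp [flowCocycle]

lemma flowCocycle_add {Ω : Type*} [TopologicalSpace Ω] {σ : ℝ → Ω → Ω}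
    (hσcont : Continuous fun p : ℝ × Ω => σ p.1 p.2)
    (hσadd : ∀ s t ω, σ (s + t) ω = σ s (σ t ω)) {a : Ω → ℝ} (ha : Continuous a)
    (s t : ℝ) (ω : Ω) :
    flowCocycle σ a (s + t) ω = flowCocycle σ a t ω + flowCocycle σ a s (σ t ω) := by
  have hc : Continuous fun u : ℝ => a (σ u ω) :=
    ha.comp (hσcont.comp (continuous_id.prodMk continuous_const))
  have h1 : flowCocycle σ a s (σ t ω) = ∫ u in t..(s + t), a (σ u ω) := by
    simp only [flowCocycle, ← hσadd]
    rw [intervalIntegral.integral_comp_add_right (fun u => a (σ u ω)), zero_add]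
  rw [h1]
  exact (intervalIntegral.integral_add_adjacent_intervals
    (hc.intervalIntegrable _ _) (hc.intervalIntegrable _ _)).symm

lemma continuous_flowCocycle {Ω : Type*} [TopologicalSpace Ω]
    {σ : ℝ → Ω → Ω} (hσcont : Continuous fun p : ℝ × Ω => σ p.1 p.2)
    {a : Ω → ℝ} (ha : Continuous a) (t : ℝ) : Continuous (flowCocycle σ a t) :=
  intervalIntegral.continuous_parametric_intervalIntegral_of_continuous'
    (f := fun ω s => a (σ s ω)) (ha.comp (hσcont.comp continuous_swap)) 0 t

/-- Gottschalk–Hedlund: a cocycle over a minimal flow that is bounded at one point, uniformly in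
time, has a continuous primitive. -/
lemma exists_primitive_of_bounded {Ω : Type*} [TopologicalSpace Ω] [Nonempty Ω]
    {σ : ℝ → Ω → Ω}
    (hσcont : Continuous fun p : ℝ × Ω => σ p.1 p.2)
    (hσadd : ∀ s t ω, σ (s + t) ω = σ s (σ t ω))
    (hmin : ∀ ω : Ω, Dense (range fun t => σ t ω))
    {a : Ω → ℝ} (ha : Continuous a) {ω₀ : Ω} {K : ℝ}
    (hK : ∀ t, |flowCocycle σ a t ω₀| ≤ K) :
    ∃ h : Ω → ℝ, Continuous h ∧ ∀ ω t, h (σ t ω) - h ω = flowCocycle σ a t ω := by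
  have hadd := flowCocycle_add hσcont hσadd ha
  have hcont := continuous_flowCocycle hσcont ha
  have hbd : ∀ ω t, |flowCocycle σ a t ω| ≤ 2 * K := by
    intro ω t
    have hcl : IsClosed {x | |flowCocycle σ a t x| ≤ 2 * K} :=
      isClosed_le (hcont t).abs continuous_const
    refine hcl.closure_subset_iff.2 ?_ (hmin ω₀ ω)
    rintro _ ⟨u, rfl⟩
    have := hadd t u ω₀
    have h1 := abs_le.1 (hK u)
    have h2 := abs_le.1 (hK (t + u))
    change |flowCocycle σ a t (σ u ω₀)| ≤ 2 * K
    rw [abs_le]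
    constructor <;> linarith
  have hba : ∀ ω, BddAbove (range fun t => flowCocycle σ a t ω) := fun ω =>
    ⟨2 * K, by rintro _ ⟨t, rfl⟩; exact (abs_le.1 (hbd ω t)).2⟩
  have hbb : ∀ ω, BddBelow (range fun t => flowCocycle σ a t ω) := fun ω =>
    ⟨-(2 * K), by rintro _ ⟨t, rfl⟩; exact (abs_le.1 (hbd ω t)).1⟩
  set u : Ω → ℝ := fun ω => ⨆ t, flowCocycle σ a t ω with hu
  set l : Ω → ℝ := fun ω => ⨅ t, flowCocycle σ a t ω with hl
  have hshift : ∀ ω s t, flowCocycle σ a t (σ s ω) =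
      flowCocycle σ a (t + s) ω - flowCocycle σ a s ω := by
    intro ω s t
    linarith [hadd t s ω]
  have hus : ∀ ω s, u (σ s ω) = u ω - flowCocycle σ a s ω := by
    intro ω s
    simp only [hu, hshift]
    rw [← ciSup_sub (by
      rcases hba ω with ⟨C, hC⟩
      exact ⟨C, by rintro _ ⟨t, rfl⟩; exact hC ⟨t + s, rfl⟩⟩)]
    exact congrArg (· - _) ((Equiv.addRight s).iSup_comp (g := fun t => flowCocycle σ a t ω))
  have hls : ∀ ω s, l (σ s ω) = l ω - flowCocycle σ a s ω := by
    intro ω s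
    simp only [hl, hshift]
    rw [← ciInf_sub (by
      rcases hbb ω with ⟨C, hC⟩
      exact ⟨C, by rintro _ ⟨t, rfl⟩; exact hC ⟨t + s, rfl⟩⟩)]
    exact congrArg (· - _) ((Equiv.addRight s).iInf_comp (g := fun t => flowCocycle σ a t ω))
  have hulsc : LowerSemicontinuous u :=
    lowerSemicontinuous_ciSup hba fun t => (hcont t).lowerSemicontinuous
  have hlusc : UpperSemicontinuous l :=
    upperSemicontinuous_ciInf hbb fun t => (hcont t).upperSemicontinuous
  have hle : ∀ x y, u x - l x ≤ u y - l y := by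
    intro x y
    have hlsc : LowerSemicontinuous fun ω => u ω - l ω := by
      have hneg : LowerSemicontinuous fun ω => -l ω := fun ω c hc => by
        filter_upwards [hlusc ω (-c) (by linarith)] with z hz
        linarith
      simpa only [sub_eq_add_neg] using hulsc.add hneg
    refine (hlsc.isClosed_preimage (u y - l y)).closure_subset_iff.2 ?_ (hmin y x)
    rintro _ ⟨t, rfl⟩
    simp [hus, hls]
  obtain ⟨z⟩ := ‹Nonempty Ω›
  have hul : ∀ x, u x = l x + (u z - l z) := fun x => by
    linarith [hle x z, hle z x]
  have huusc : UpperSemicontinuous u := fun ω c hc => by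
    change u ω < c at hc
    filter_upwards [hlusc ω (c - (u z - l z)) (by linarith [hul ω])] with w hw
    linarith [hul w]
  refine ⟨fun ω => -u ω, (continuous_iff_lower_upperSemicontinuous.2 ⟨hulsc, huusc⟩).neg, ?_⟩
  intro ω t
  linarith [hus ω t]

/-- Half-orbit version of Gottschalk–Hedlund, for any shift-invariant filter of times. -/
lemma exists_primitive_of_eventually_bounded {Ω : Type*} [TopologicalSpace Ω] [CompactSpace Ω]
    {σ : ℝ → Ω → Ω}
    (hσcont : Continuous fun p : ℝ × Ω => σ p.1 p.2)
    (hσadd : ∀ s t ω, σ (s + t) ω = σ s (σ t ω))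
    (hmin : ∀ ω : Ω, Dense (range fun t => σ t ω))
    {a : Ω → ℝ} (ha : Continuous a) (F : Filter ℝ) [F.NeBot]
    (hF : ∀ s : ℝ, Tendsto (fun t => s + t) F F) {ω₀ : Ω} {K : ℝ}
    (hK : ∀ᶠ t in F, |flowCocycle σ a t ω₀| ≤ K) :
    ∃ h : Ω → ℝ, Continuous h ∧ ∀ ω t, h (σ t ω) - h ω = flowCocycle σ a t ω := by
  obtain ⟨x, hx⟩ := exists_clusterPt_of_compactSpace (map (fun t => σ t ω₀) F)
  have : Nonempty Ω := ⟨x⟩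
  refine exists_primitive_of_bounded hσcont hσadd hmin ha (ω₀ := x) (K := 2 * K) fun s => ?_
  have hcl : IsClosed {y | |flowCocycle σ a s y| ≤ 2 * K} :=
    isClosed_le (continuous_flowCocycle hσcont ha s).abs continuous_const
  have hmem : ∀ᶠ t in F, |flowCocycle σ a s (σ t ω₀)| ≤ 2 * K := by
    filter_upwards [hK, (hF s).eventually hK] with t h1 h2
    have := flowCocycle_add hσcont hσadd ha s t ω₀
    rw [abs_le] at h1 h2 ⊢
    constructor <;> linarith
  refine hcl.closure_subset_iff.2 Subset.rfl
    (mem_closure_iff_clusterPt.2 (hx.mono (le_principal_iff.2 hmem)))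

/-- If a nonnegative measurable `f` satisfies `f ≤ f ∘ T + φ` with `T` measure preserving and `φ`
bounded of zero mean, then equality holds almost everywhere. -/
lemma ae_eq_comp_add_of_le {Ω : Type*} [MeasurableSpace Ω] {m : Measure Ω}
    [IsProbabilityMeasure m] {T : Ω → Ω} (hT : MeasurePreserving T m m)
    {f φ : Ω → ℝ} (hf : Measurable f) (hf0 : ∀ ω, 0 ≤ f ω) (hφ : Measurable φ)
    {K : ℝ} (hφK : ∀ ω, |φ ω| ≤ K) (hφ0 : ∫ ω, φ ω ∂m = 0)
    (hle : ∀ᵐ ω ∂m, f ω ≤ f (T ω) + φ ω) :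
    ∀ᵐ ω ∂m, f ω = f (T ω) + φ ω := by
  have hφi : Integrable φ m :=
    Integrable.of_bound hφ.aestronglyMeasurable K (ae_of_all _ hφK)
  have hfT : Measurable fun ω => f (T ω) := hf.comp hT.measurable
  set g : ℕ → Ω → ENNReal := fun n ω =>
    ENNReal.ofReal (min (f (T ω)) n - min (f ω) n + K) with hg
  have hgm : ∀ n, Measurable (g n) := fun n =>
    (((hfT.min measurable_const).sub (hf.min measurable_const)).add_const K).ennreal_ofReal
  have hgi : ∀ n, ∫⁻ ω, g n ω ∂m = ENNReal.ofReal K := by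
    intro n
    have hi : Integrable (fun ω => min (f ω) n) m :=
      Integrable.of_bound (hf.min measurable_const).aestronglyMeasurable n
        (ae_of_all _ fun ω => by
          rw [Real.norm_of_nonneg (le_min (hf0 ω) n.cast_nonneg)]
          exact min_le_right _ _)
    have hiT : Integrable (fun ω => min (f (T ω)) n) m := hT.integrable_comp_of_integrable hi
    have heq : ∫ ω, min (f (T ω)) n ∂m = ∫ ω, min (f ω) n ∂m := by
      conv_rhs => rw [← hT.map_eq]
      rw [integral_map hT.measurable.aemeasurable
        (hf.min measurable_const).aestronglyMeasurable]
    have hint : Integrable (fun ω => min (f (T ω)) n - min (f ω) n + K) m :=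
      (hiT.sub hi).add (integrable_const K)
    simp only [hg]
    rw [← ofReal_integral_eq_lintegral_ofReal hint]
    · rw [integral_add (f := fun ω => min (f (T ω)) n - min (f ω) n) (hiT.sub hi)
        (integrable_const K), integral_sub hiT hi, heq]
      simp
    · filter_upwards [hle] with ω hω
      have h1 := abs_le.1 (hφK ω)
      simp only [Pi.zero_apply]
      rcases min_cases (f (T ω)) (n : ℝ) with h | h <;>
        rcases min_cases (f ω) (n : ℝ) with h' | h' <;> linarith
  have hlim : ∀ ω, Tendsto (fun n => g n ω) atTop
      (𝓝 (ENNReal.ofReal (f (T ω) - f ω + K))) := by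
    intro ω
    refine tendsto_const_nhds.congr' ?_
    obtain ⟨N, hN⟩ := exists_nat_ge (max (f (T ω)) (f ω))
    filter_upwards [eventually_ge_atTop N] with n hn
    have hn' : (N : ℝ) ≤ n := by exact_mod_cast hn
    simp only [hg]
    rw [min_eq_left ((le_max_left _ _).trans (hN.trans hn')),
      min_eq_left ((le_max_right _ _).trans (hN.trans hn'))]
  have hfatou : ∫⁻ ω, ENNReal.ofReal (f (T ω) - f ω + K) ∂m ≤ ENNReal.ofReal K := by
    have := lintegral_liminf_le (μ := m) (u := atTop) hgm
    simp only [hgi, liminf_const, fun ω => (hlim ω).liminf_eq] at this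
    exact this
  have hKφ : ∫⁻ ω, ENNReal.ofReal (K - φ ω) ∂m = ENNReal.ofReal K := by
    have hint : Integrable (fun ω => K - φ ω) m := (integrable_const K).sub hφi
    rw [← ofReal_integral_eq_lintegral_ofReal hint
      (ae_of_all _ fun ω => sub_nonneg.2 (abs_le.1 (hφK ω)).2),
      integral_sub (integrable_const K) hφi, hφ0]
    simp
  have hae := ae_eq_of_ae_le_of_lintegral_le
    (f := fun ω => ENNReal.ofReal (K - φ ω))
    (g := fun ω => ENNReal.ofReal (f (T ω) - f ω + K)) (μ := m)
    (by filter_upwards [hle] with ω hω using ENNReal.ofReal_le_ofReal (by linarith))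
    (by rw [hKφ]; exact ENNReal.ofReal_ne_top)
    ((hfT.sub hf).add_const K).ennreal_ofReal.aemeasurable (by rw [hKφ]; exact hfatou)
  filter_upwards [hae, hle] with ω h1 h2
  have h3 := abs_le.1 (hφK ω)
  rw [ENNReal.ofReal_eq_ofReal_iff (by linarith) (by linarith)] at h1
  linarith

lemma integral_flowCocycle {Ω : Type*} [TopologicalSpace Ω] [CompactSpace Ω]
    [SecondCountableTopology Ω] [MeasurableSpace Ω] [BorelSpace Ω] {σ : ℝ → Ω → Ω}
    (hσcont : Continuous fun p : ℝ × Ω => σ p.1 p.2)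
    (m : Measure Ω) [IsProbabilityMeasure m] (hminv : ∀ t, Measure.map (σ t) m = m)
    {a : Ω → ℝ} (ha : Continuous a) (hint : ∫ ω, a ω ∂m = 0) (t : ℝ) :
    ∫ ω, flowCocycle σ a t ω ∂m = 0 := by
  have hs : ∀ s, ∫ ω, a (σ s ω) ∂m = 0 := fun s => by
    have hσs : Continuous (σ s) := hσcont.comp (continuous_const.prodMk continuous_id)
    rw [← integral_map hσs.measurable.aemeasurable
      ha.measurable.aestronglyMeasurable, hminv, hint]
  obtain ⟨C, hC⟩ := isCompact_univ.exists_bound_of_continuousOn ha.continuousOn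
  unfold flowCocycle
  rw [← intervalIntegral_integral_swap]
  · simp [hs]
  · have : IsFiniteMeasure (volume.restrict (uIoc 0 t)) :=
      ⟨by simp⟩
    exact Integrable.of_bound (ha.comp hσcont).measurable.aestronglyMeasurable C
      (ae_of_all _ fun p => hC _ (mem_univ _))

/-- The supremum of the cocycle over the past half-orbit, as an extended nonnegative real. -/
noncomputable def pastSup {Ω : Type*} (σ : ℝ → Ω → Ω) (a : Ω → ℝ) (ω : Ω) : ENNReal :=
  ⨆ t : Iic (0:ℝ), ENNReal.ofReal (flowCocycle σ a t ω)

lemma measurable_pastSup {Ω : Type*} [TopologicalSpace Ω] [MeasurableSpace Ω] [BorelSpace Ω]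
    {σ : ℝ → Ω → Ω} (hσcont : Continuous fun p : ℝ × Ω => σ p.1 p.2)
    {a : Ω → ℝ} (ha : Continuous a) : Measurable (pastSup σ a) :=
  (lowerSemicontinuous_iSup fun t : Iic (0:ℝ) => (ENNReal.continuous_ofReal.comp
    (continuous_flowCocycle hσcont ha t)).lowerSemicontinuous).measurable

lemma pastSup_le {Ω : Type*} {σ : ℝ → Ω → Ω} {a : Ω → ℝ} {ω : Ω} {C : ℝ}
    (hC : ∀ t ≤ (0:ℝ), flowCocycle σ a t ω ≤ C) : pastSup σ a ω ≤ ENNReal.ofReal C :=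
  iSup_le fun t => ENNReal.ofReal_le_ofReal (hC t t.2)

lemma flowCocycle_le_toReal_pastSup {Ω : Type*} {σ : ℝ → Ω → Ω} {a : Ω → ℝ} {ω : Ω}
    (h : pastSup σ a ω ≠ ⊤) {t : ℝ} (ht : t ≤ 0) :
    flowCocycle σ a t ω ≤ (pastSup σ a ω).toReal :=
  (ENNReal.ofReal_le_iff_le_toReal h).1
    (le_iSup (fun t : Iic (0:ℝ) => ENNReal.ofReal (flowCocycle σ a t ω)) ⟨t, ht⟩)

lemma pastSup_ne_top_iff {Ω : Type*} {σ : ℝ → Ω → Ω} {a : Ω → ℝ} {ω : Ω} :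
    pastSup σ a ω ≠ ⊤ ↔ ∃ C : ℝ, ∀ t ≤ (0:ℝ), flowCocycle σ a t ω ≤ C :=
  ⟨fun h => ⟨_, fun _ ht => flowCocycle_le_toReal_pastSup h ht⟩,
    fun ⟨_, hC⟩ => ((pastSup_le hC).trans_lt ENNReal.ofReal_lt_top).ne⟩

/-- A zero-mean cocycle bounded above on almost every past half-orbit is bounded above on almost
every full orbit. -/
lemma ae_bddAbove_of_ae_past {Ω : Type*} [TopologicalSpace Ω] [CompactSpace Ω]
    [SecondCountableTopology Ω] [MeasurableSpace Ω] [BorelSpace Ω] {σ : ℝ → Ω → Ω}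
    (hσcont : Continuous fun p : ℝ × Ω => σ p.1 p.2)
    (hσadd : ∀ s t ω, σ (s + t) ω = σ s (σ t ω))
    (m : Measure Ω) [IsProbabilityMeasure m] (hminv : ∀ t, Measure.map (σ t) m = m)
    {a : Ω → ℝ} (ha : Continuous a) (hint : ∫ ω, a ω ∂m = 0)
    (hpast : ∀ᵐ ω ∂m, ∃ C : ℝ, ∀ t ≤ (0:ℝ), flowCocycle σ a t ω ≤ C) :
    ∀ᵐ ω ∂m, ∃ C : ℝ, ∀ t, flowCocycle σ a t ω ≤ C := by
  have hadd := flowCocycle_add hσcont hσadd ha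
  have hmp : ∀ s, MeasurePreserving (σ s) m m := fun s =>
    ⟨(hσcont.comp (continuous_const.prodMk continuous_id)).measurable, hminv s⟩
  have hfin : ∀ᵐ ω ∂m, pastSup σ a ω ≠ ⊤ := by
    filter_upwards [hpast] with ω hω using pastSup_ne_top_iff.2 hω
  have hfinT : ∀ s, ∀ᵐ ω ∂m, pastSup σ a (σ s ω) ≠ ⊤ := fun s =>
    (hmp s).quasiMeasurePreserving.ae hfin
  have key : ∀ n : ℕ, ∀ᵐ ω ∂m, (pastSup σ a ω).toReal =
      (pastSup σ a (σ n ω)).toReal + flowCocycle σ a n ω := by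
    intro n
    have hc := continuous_flowCocycle hσcont ha (n : ℝ)
    obtain ⟨K, hK⟩ := isCompact_univ.exists_bound_of_continuousOn hc.continuousOn
    refine ae_eq_comp_add_of_le (hmp n) (f := fun ω => (pastSup σ a ω).toReal)
      (measurable_pastSup hσcont ha).ennreal_toReal (fun _ => ENNReal.toReal_nonneg)
      hc.measurable (fun ω => hK ω (mem_univ _))
      (integral_flowCocycle hσcont m hminv ha hint _) ?_
    filter_upwards [hfinT n] with ω hω
    have h0 : ∀ t ≤ (0:ℝ), flowCocycle σ a t ω ≤
        (pastSup σ a (σ n ω)).toReal + flowCocycle σ a n ω := by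
      intro t ht
      have h1 := flowCocycle_le_toReal_pastSup hω (t := t - n)
        (by linarith [n.cast_nonneg (α := ℝ)])
      have h2 := hadd (t - n) n ω
      rw [sub_add_cancel] at h2
      linarith
    refine ENNReal.toReal_le_of_le_ofReal ?_ (pastSup_le h0)
    simpa only [flowCocycle_zero] using h0 0 le_rfl
  filter_upwards [ae_all_iff.2 key, ae_all_iff.2 fun n : ℕ => hfinT n] with ω h1 h2
  refine ⟨(pastSup σ a ω).toReal, fun t => ?_⟩
  obtain ⟨n, hn⟩ := exists_nat_ge t
  have h3 := flowCocycle_le_toReal_pastSup (h2 n) (t := t - n) (by linarith)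
  have h4 := hadd (t - n) n ω
  rw [sub_add_cancel] at h4
  linarith [h1 n]

/-- The points whose cocycle is bounded above over `ℝ` and unbounded below over both
half-lines. -/
def oscillationSet {Ω : Type*} (σ : ℝ → Ω → Ω) (a : Ω → ℝ) : Set Ω :=
  {ω : Ω | (∃ C : ℝ, ∀ t : ℝ, flowCocycle σ a t ω ≤ C) ∧
    (∀ C : ℝ, ∃ t ≤ (0:ℝ), flowCocycle σ a t ω < C) ∧
    (∀ C : ℝ, ∃ t ≥ (0:ℝ), flowCocycle σ a t ω < C)}

lemma flow_mem_oscillationSet {Ω : Type*} [TopologicalSpace Ω] {σ : ℝ → Ω → Ω}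
    (hσcont : Continuous fun p : ℝ × Ω => σ p.1 p.2)
    (hσadd : ∀ s t ω, σ (s + t) ω = σ s (σ t ω)) {a : Ω → ℝ} (ha : Continuous a)
    {ω : Ω} (hω : ω ∈ oscillationSet σ a) (t : ℝ) : σ t ω ∈ oscillationSet σ a := by
  have hadd := flowCocycle_add hσcont hσadd ha
  have hc : Continuous fun u : ℝ => a (σ u ω) :=
    ha.comp (hσcont.comp (continuous_id.prodMk continuous_const))
  have hct : Continuous fun u => flowCocycle σ a u ω :=
    intervalIntegral.continuous_primitive (fun _ _ => hc.intervalIntegrable _ _) 0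
  obtain ⟨B, hB⟩ := (isCompact_Icc (a := -|t|) (b := |t|)).exists_bound_of_continuousOn
    hct.continuousOn
  obtain ⟨⟨C, hC⟩, hneg, hpos⟩ := hω
  have hfar : ∀ {u}, flowCocycle σ a u ω < -B → -|t| ≤ u → |t| < u := by
    intro u hu h1
    by_contra! h2
    linarith [(abs_le.1 (hB u ⟨h1, h2⟩)).1]
  have hshift : ∀ u, flowCocycle σ a (u - t) (σ t ω) =
      flowCocycle σ a u ω - flowCocycle σ a t ω := by
    intro u
    have := hadd (u - t) t ω
    rw [sub_add_cancel] at this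
    linarith
  refine ⟨⟨C - flowCocycle σ a t ω, fun s => by linarith [hadd s t ω, hC (s + t)]⟩,
    fun D => ?_, fun D => ?_⟩
  · obtain ⟨u, hu0, hu⟩ := hneg (min (-B) (D + flowCocycle σ a t ω))
    obtain ⟨hu1, hu2⟩ := lt_min_iff.1 hu
    refine ⟨u - t, ?_, by linarith [hshift u]⟩
    by_contra! h
    linarith [hfar hu1 (by linarith [neg_abs_le t]), abs_nonneg t]
  · obtain ⟨u, hu0, hu⟩ := hpos (min (-B) (D + flowCocycle σ a t ω))
    obtain ⟨hu1, hu2⟩ := lt_min_iff.1 hu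
    refine ⟨u - t, ?_, by linarith [hshift u]⟩
    linarith [hfar hu1 (by linarith [abs_nonneg t]), le_abs_self t]

/-- Characterization of membership in `R_m(Ω)`: for a minimal flow, a
`σ`-ergodic Borel probability measure `m` and a continuous `a` with `∫ a dm = 0`,
`a ∈ R_m(Ω)` if and only if the set `Ω^a` of points whose integral cocycle is bounded above
over all of `ℝ` and unbounded below over both half-lines is `σ`-invariant with full
measure. -/
theorem stmt6 {Ω : Type*} [MetricSpace Ω] [CompactSpace Ω] [Nonempty Ω]
    [MeasurableSpace Ω] [BorelSpace Ω]
    (σ : ℝ → Ω → Ω)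
    (hσcont : Continuous fun p : ℝ × Ω => σ p.1 p.2)
    (hσ0 : ∀ ω, σ 0 ω = ω)
    (hσadd : ∀ s t ω, σ (s + t) ω = σ s (σ t ω))
    (hmin : ∀ ω : Ω, Dense (Set.range fun t => σ t ω))
    (m : Measure Ω) [IsProbabilityMeasure m]
    (hminv : ∀ t, Measure.map (σ t) m = m)
    (herg : ∀ B : Set Ω, MeasurableSet B → (∀ t, σ t ⁻¹' B = B) → m B = 0 ∨ m B = 1)
    (a : Ω → ℝ) (ha : Continuous a)
    (hint : ∫ ω, a ω ∂m = 0) :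
    ((¬ ∃ h : Ω → ℝ, Continuous h ∧
        ∀ ω t, h (σ t ω) - h ω = ∫ s in (0:ℝ)..t, a (σ s ω)) ∧
      (∀ᵐ ω ∂m, ∃ C : ℝ, ∀ t ≤ (0:ℝ), (∫ s in (0:ℝ)..t, a (σ s ω)) ≤ C)) ↔
    ((∀ ω ∈ {ω : Ω | (∃ C : ℝ, ∀ t : ℝ, (∫ s in (0:ℝ)..t, a (σ s ω)) ≤ C) ∧
          (∀ C : ℝ, ∃ t ≤ (0:ℝ), (∫ s in (0:ℝ)..t, a (σ s ω)) < C) ∧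
          (∀ C : ℝ, ∃ t ≥ (0:ℝ), (∫ s in (0:ℝ)..t, a (σ s ω)) < C)},
        ∀ t : ℝ, σ t ω ∈ {ω : Ω | (∃ C : ℝ, ∀ t : ℝ, (∫ s in (0:ℝ)..t, a (σ s ω)) ≤ C) ∧
          (∀ C : ℝ, ∃ t ≤ (0:ℝ), (∫ s in (0:ℝ)..t, a (σ s ω)) < C) ∧
          (∀ C : ℝ, ∃ t ≥ (0:ℝ), (∫ s in (0:ℝ)..t, a (σ s ω)) < C)}) ∧
      m {ω : Ω | (∃ C : ℝ, ∀ t : ℝ, (∫ s in (0:ℝ)..t, a (σ s ω)) ≤ C) ∧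
          (∀ C : ℝ, ∃ t ≤ (0:ℝ), (∫ s in (0:ℝ)..t, a (σ s ω)) < C) ∧
          (∀ C : ℝ, ∃ t ≥ (0:ℝ), (∫ s in (0:ℝ)..t, a (σ s ω)) < C)} = 1) := by
  have hadd := flowCocycle_add hσcont hσadd ha
  change ((¬ ∃ h : Ω → ℝ, Continuous h ∧ ∀ ω t, h (σ t ω) - h ω = flowCocycle σ a t ω) ∧
      (∀ᵐ ω ∂m, ∃ C : ℝ, ∀ t ≤ (0:ℝ), flowCocycle σ a t ω ≤ C)) ↔
    (∀ ω ∈ oscillationSet σ a, ∀ t, σ t ω ∈ oscillationSet σ a) ∧ m (oscillationSet σ a) = 1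
  constructor
  · rintro ⟨hprim, hpast⟩
    refine ⟨fun ω hω t => flow_mem_oscillationSet hσcont hσadd ha hω t, ?_⟩
    suffices h : ∀ᵐ ω ∂m, ω ∈ oscillationSet σ a by
      exact (measure_congr (eventuallyEq_univ.2 h)).trans measure_univ
    filter_upwards [ae_bddAbove_of_ae_past hσcont hσadd m hminv ha hint hpast] with ω hω
    obtain ⟨C, hC⟩ := hω
    have habs : ∀ {D u}, D ≤ flowCocycle σ a u ω → |flowCocycle σ a u ω| ≤ max C (-D) :=
      fun h => abs_le'.2 ⟨(hC _).trans (le_max_left _ _), (neg_le_neg h).trans (le_max_right _ _)⟩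
    refine ⟨⟨C, hC⟩, fun D => ?_, fun D => ?_⟩ <;> by_contra! hD
    · exact hprim (exists_primitive_of_eventually_bounded hσcont hσadd hmin ha atBot
        (fun s => tendsto_atBot_add_const_left _ s tendsto_id)
        ((eventually_le_atBot 0).mono fun u hu => habs (hD u hu)))
    · exact hprim (exists_primitive_of_eventually_bounded hσcont hσadd hmin ha atTop
        (fun s => tendsto_atTop_add_const_left _ s tendsto_id)
        ((eventually_ge_atTop 0).mono fun u hu => habs (hD u hu)))
  · rintro ⟨-, hm⟩
    constructor
    · rintro ⟨h, hc, hh⟩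
      obtain ⟨ω, -, hneg, -⟩ : (oscillationSet σ a).Nonempty :=
        nonempty_of_measure_ne_zero (μ := m) (by rw [hm]; exact one_ne_zero)
      obtain ⟨B, hB⟩ := isCompact_univ.exists_bound_of_continuousOn hc.continuousOn
      obtain ⟨t, -, ht⟩ := hneg (-(2 * B))
      have h1 := abs_le.1 (hB (σ t ω) (mem_univ _))
      have h2 := abs_le.1 (hB ω (mem_univ _))
      linarith [hh ω t]
    · have hmeas : MeasurableSet {ω | pastSup σ a ω ≠ ⊤} :=
        (measurable_pastSup hσcont ha (measurableSet_singleton ⊤)).compl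
      have hsub : oscillationSet σ a ⊆ {ω | pastSup σ a ω ≠ ⊤} := fun ω hω =>
        pastSup_ne_top_iff.2 (hω.1.imp fun C hC t _ => hC t)
      have h1 : m {ω | pastSup σ a ω ≠ ⊤} = 1 :=
        le_antisymm prob_le_one (hm ▸ measure_mono hsub)
      have hae : ∀ᵐ ω ∂m, pastSup σ a ω ≠ ⊤ := (prob_compl_eq_zero_iff hmeas).2 h1
      exact hae.mono fun ω hω => pastSup_ne_top_iff.1 hω
end

section
/- Let σ be a minimal continuous flow on a nonempty compact metric space Ω, let m be a σ-ergodic Borel probability measure on Ω, and let a ∈ R_m(Ω). Define H_a : Ω → ℝ by H_a(ω) := inf_{t ∈ ℝ} exp(−∫_0^t a(ω·s) ds), and Ω^a := { ω ∈ Ω : sup_{t ∈ ℝ} ∫_0^t a(ω·s) ds < ∞ }. Then: (1) H_a is upper semicontinuous and takes values in [0,1]; (2) H_a(ω) > 0 if and only if ω ∈ Ω^a, and Ω^a is σ-invariant with m(Ω^a) = 1; (3) H_a(ω·t) = H_a(ω)·exp(∫_0^t a(ω·s) ds) for all ω ∈ Ω and t ∈ ℝ; (4) inf_{t ≤ 0}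 H_a(ω·t) = 0 and inf_{t ≥ 0} H_a(ω·t) = 0 for every ω ∈ Ω. -/
open MeasureTheory

open Filter Topology

/-- In a minimal flow on a compact space, a closed set that eventually contains a half-orbit
is the whole space. -/
theorem eq_univ_of_isClosed_of_eventually_mem {Ω : Type*} [TopologicalSpace Ω] [CompactSpace Ω]
    {σ : ℝ → Ω → Ω} (hσcont : ∀ t, Continuous (σ t))
    (hσadd : ∀ s t ω, σ (s + t) ω = σ s (σ t ω))
    (hmin : ∀ ω : Ω, Dense (Set.range fun t => σ t ω))
    {l : Filter ℝ} [l.NeBot] (hl : ∀ s : ℝ, Tendsto (fun t => s + t) l l)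
    {C : Set Ω} (hC : IsClosed C) {ω : Ω} (hω : ∀ᶠ t in l, σ t ω ∈ C) : C = Set.univ := by
  obtain ⟨x, -, hx⟩ := isCompact_univ (X := Ω) (f := map (fun t => σ t ω) l) (by simp)
  have hmem : ∀ s, σ s x ∈ C := by
    intro s
    have h1 : MapClusterPt (σ s x) l (fun t => σ s (σ t ω)) :=
      MapClusterPt.continuousAt_comp (u := fun t => σ t ω) (hσcont s).continuousAt hx
    refine isClosed_iff_clusterPt.1 hC _ (ClusterPt.mono h1 ?_)
    rw [le_principal_iff, mem_map]
    filter_upwards [(hl s).eventually hω] with t ht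
    simpa [hσadd] using ht
  refine Set.eq_univ_of_univ_subset ?_
  rw [← (hmin x).closure_eq]
  exact hC.closure_subset_iff.2 (by rintro _ ⟨s, rfl⟩; exact hmem s)

/-- Gottschalk–Hedlund: a bounded continuous additive cocycle over a minimal flow is the
coboundary of a continuous function. -/
theorem exists_continuous_primitive_of_bounded {Ω : Type*} [TopologicalSpace Ω]
    {σ : ℝ → Ω → Ω} (hmin : ∀ ω : Ω, Dense (Set.range fun t => σ t ω))
    {A : ℝ → Ω → ℝ} (hA : ∀ t, Continuous (A t))
    (hadd : ∀ s t ω, A (s + t) ω = A s (σ t ω) + A t ω)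
    {C : ℝ} (hC : ∀ t ω, |A t ω| ≤ C) :
    ∃ h : Ω → ℝ, Continuous h ∧ ∀ ω t, h (σ t ω) - h ω = A t ω := by
  have hbelow : ∀ ω, BddBelow (Set.range fun t => -A t ω) := fun ω =>
    ⟨-C, by rintro _ ⟨t, rfl⟩; exact neg_le_neg (abs_le.1 (hC t ω)).2⟩
  have habove : ∀ ω, BddAbove (Set.range fun t => -A t ω) := fun ω =>
    ⟨C, by rintro _ ⟨t, rfl⟩; exact neg_le.1 (abs_le.1 (hC t ω)).1⟩
  set u : Ω → ℝ := fun ω => ⨅ t, -A t ω with hu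
  set w : Ω → ℝ := fun ω => ⨆ t, -A t ω with hw
  have hneg : ∀ s t ω, -A s (σ t ω) = -A (s + t) ω + A t ω := fun s t ω => by
    rw [hadd]; ring
  have hu_usc : UpperSemicontinuous u :=
    upperSemicontinuous_ciInf hbelow fun t => (hA t).neg.upperSemicontinuous
  have hw_lsc : LowerSemicontinuous w :=
    lowerSemicontinuous_ciSup habove fun t => (hA t).neg.lowerSemicontinuous
  have hu_add : ∀ t ω, u (σ t ω) = u ω + A t ω := by
    intro t ω
    simp only [hu, hneg]
    rw [← ciInf_add (f := fun s => -A (s + t) ω)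
      ((hbelow ω).mono (by rintro _ ⟨s, rfl⟩; exact ⟨s + t, rfl⟩))]
    congr 1
    exact (Equiv.addRight t).iInf_comp (g := fun s => -A s ω)
  have hw_add : ∀ t ω, w (σ t ω) = w ω + A t ω := by
    intro t ω
    simp only [hw, hneg]
    rw [← ciSup_add (f := fun s => -A (s + t) ω)
      ((habove ω).mono (by rintro _ ⟨s, rfl⟩; exact ⟨s + t, rfl⟩))]
    congr 1
    exact (Equiv.addRight t).iSup_comp (g := fun s => -A s ω)
  have hd_lsc : LowerSemicontinuous fun ω => w ω + -u ω :=
    hw_lsc.add (continuous_neg.comp_upperSemicontinuous_antitone hu_usc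
      fun _ _ h => neg_le_neg h)
  have hd_le : ∀ x y, w y + -u y ≤ w x + -u x := by
    intro x y
    have hcl := hd_lsc.isClosed_preimage (w x + -u x)
    have hsub : (Set.range fun t => σ t x) ⊆
        (fun ω => w ω + -u ω) ⁻¹' Set.Iic (w x + -u x) := by
      rintro _ ⟨t, rfl⟩
      simp only [Set.mem_preimage, Set.mem_Iic, hu_add, hw_add]
      linarith
    exact hcl.closure_subset_iff.2 hsub (hmin x y)
  refine ⟨u, continuous_iff_lower_upperSemicontinuous.2 ⟨?_, hu_usc⟩, fun ω t => ?_⟩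
  · intro x
    have hux : u = fun y => w y + -(w x + -u x) := by
      ext y
      linarith [hd_le x y, hd_le y x]
    rw [hux]
    exact hw_lsc.add lowerSemicontinuous_const x
  · rw [hu_add]; ring

/-- The increment of a measurable function along a measure-preserving map has zero integral as
soon as it is integrable, even if the function itself is not integrable. -/
theorem integral_comp_sub_eq_zero {Ω : Type*} [MeasurableSpace Ω] {m : Measure Ω}
    [IsFiniteMeasure m] {T : Ω → Ω} (hT : MeasurePreserving T m m) {g : Ω → ℝ}
    (hg : Measurable g) (hint : Integrable (fun ω => g (T ω) - g ω) m) :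
    ∫ ω, (g (T ω) - g ω) ∂m = 0 := by
  set τ : ℕ → ℝ → ℝ := fun N x => max (-(N : ℝ)) (min x N) with hτ
  have hτ_meas : ∀ N, Measurable (τ N) := fun N =>
    measurable_const.max (measurable_id.min measurable_const)
  have hτ_abs : ∀ N x, |τ N x| ≤ N := fun N x => by
    have : (0 : ℝ) ≤ N := N.cast_nonneg
    rw [abs_le]
    exact ⟨le_max_left _ _, max_le (by linarith) (min_le_right _ _)⟩
  have hτ_lip : ∀ N x y, |τ N x - τ N y| ≤ |x - y| := fun N x y => by
    refine (abs_max_sub_max_le_max _ _ _ _).trans (max_le (by simp) ?_)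
    exact (abs_min_sub_min_le_max _ _ _ _).trans (max_le le_rfl (by simp))
  have hτ_eq : ∀ x, ∀ᶠ N in atTop, τ N x = x := fun x => by
    filter_upwards [eventually_ge_atTop ⌈|x|⌉₊] with N hN
    have h := abs_le.1 (Nat.ceil_le.1 hN)
    simp only [hτ]
    rw [min_eq_left h.2, max_eq_right h.1]
  have hτ_int : ∀ N, Integrable (fun ω => τ N (g ω)) m := fun N =>
    Integrable.of_bound ((hτ_meas N).comp hg).aestronglyMeasurable N
      (Eventually.of_forall fun ω => hτ_abs N _)
  have hzero : ∀ N, ∫ ω, (τ N (g (T ω)) - τ N (g ω)) ∂m = 0 := fun N => by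
    have hτT_int : Integrable (fun ω => τ N (g (T ω))) m :=
      hT.integrable_comp_of_integrable (hτ_int N)
    rw [integral_sub hτT_int (hτ_int N), sub_eq_zero]
    have := integral_map (μ := m) hT.aemeasurable
      (f := fun ω => τ N (g ω)) ((hτ_meas N).comp hg).aestronglyMeasurable
    rw [hT.map_eq] at this
    exact this.symm
  have hlim : Tendsto (fun N => ∫ ω, (τ N (g (T ω)) - τ N (g ω)) ∂m) atTop
      (𝓝 (∫ ω, (g (T ω) - g ω) ∂m)) := by
    refine tendsto_integral_of_dominated_convergence (fun ω => |g (T ω) - g ω|) (fun N => ?_)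
      hint.abs (fun N => Eventually.of_forall fun ω => hτ_lip N _ _)
      (Eventually.of_forall fun ω => ?_)
    · exact (((hτ_meas N).comp (hg.comp hT.measurable)).sub
        ((hτ_meas N).comp hg)).aestronglyMeasurable
    · refine tendsto_const_nhds.congr' ?_
      filter_upwards [hτ_eq (g (T ω)), hτ_eq (g ω)] with N h1 h2
      rw [h1, h2]
  simp only [hzero] at hlim
  exact (tendsto_nhds_unique hlim tendsto_const_nhds)

/-- If a continuous additive cocycle over a measure-preserving flow has bounded increments over
unit time and mean-zero time-one map, then boundedness from above on almost every backward
half-orbit forces boundedness from above on almost every orbit. -/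
theorem ae_bddAbove_of_ae_bddAbove_nonpos {Ω : Type*} [TopologicalSpace Ω] [MeasurableSpace Ω]
    [OpensMeasurableSpace Ω] {σ : ℝ → Ω → Ω}
    (hσ0 : ∀ ω, σ 0 ω = ω) {m : Measure Ω} [IsFiniteMeasure m]
    (hpres : ∀ t, MeasurePreserving (σ t) m m)
    {A : ℝ → Ω → ℝ} (hA : ∀ t, Continuous (A t))
    (hadd : ∀ s t ω, A (s + t) ω = A s (σ t ω) + A t ω)
    {c : ℝ} (hc : ∀ t ∈ Set.Icc (0 : ℝ) 1, ∀ ω, |A t ω| ≤ c)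
    (hmean : ∫ ω, A 1 ω ∂m = 0)
    (hbdd : ∀ᵐ ω ∂m, ∃ C : ℝ, ∀ t ≤ (0 : ℝ), A t ω ≤ C) :
    ∀ᵐ ω ∂m, ∃ C : ℝ, ∀ t : ℝ, A t ω ≤ C := by
  have hA0 : ∀ ω, A 0 ω = 0 := fun ω => by
    have := hadd 0 0 ω
    rw [hσ0, add_zero] at this
    linarith
  have hc0 : ∀ ω : Ω, 0 ≤ c := fun ω => (abs_nonneg _).trans (hc 0 (by simp) ω)
  set F : ℝ → Ω → ℝ := fun b ω => ⨅ r : Set.Iic b, Real.exp (-A r.1 ω) with hF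
  have hbelow : ∀ b ω, BddBelow (Set.range fun r : Set.Iic b => Real.exp (-A r.1 ω)) :=
    fun b ω =>
    ⟨0, by rintro _ ⟨r, rfl⟩; exact (Real.exp_pos _).le⟩
  have hF_le : ∀ b ω r, r ≤ b → F b ω ≤ Real.exp (-A r ω) := fun b ω r hr =>
    ciInf_le (hbelow b ω) ⟨r, hr⟩
  have hF_usc : ∀ b, UpperSemicontinuous (F b) := fun b =>
    upperSemicontinuous_ciInf (hbelow b) fun r =>
      (Real.continuous_exp.comp (hA r).neg).upperSemicontinuous
  have hF_meas : ∀ b, Measurable (F b) := fun b => (hF_usc b).measurable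
  have hF_shift : ∀ b t ω, F b (σ t ω) = F (b + t) ω * Real.exp (A t ω) := by
    intro b t ω
    simp only [hF]
    rw [Real.iInf_mul_of_nonneg (Real.exp_pos _).le]
    refine Equiv.iInf_congr ((Equiv.addRight t).subtypeEquiv fun r => by simp) fun r => ?_
    rw [← Real.exp_add]
    simp only [Equiv.subtypeEquiv_apply, Equiv.coe_addRight, hadd]
    congr 1; ring
  have hF10 : ∀ ω, F 1 ω ≤ F 0 ω := fun ω =>
    le_ciInf fun r => hF_le 1 ω r (r.2.trans zero_le_one)
  have hF0_nonneg : ∀ ω, 0 ≤ F 0 ω := fun ω => Real.iInf_nonneg fun r => (Real.exp_pos _).le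
  have hF0_le : ∀ ω, F 0 ω ≤ 1 := fun ω => by simpa [hA0] using hF_le 0 ω 0 le_rfl
  have hF01 : ∀ ω, Real.exp (-c) * F 0 ω ≤ F 1 ω := by
    refine fun ω => le_ciInf fun r => ?_
    rcases le_total (r : ℝ) 0 with hr | hr
    · refine le_trans ?_ (hF_le 0 ω r hr)
      exact mul_le_of_le_one_left (hF0_nonneg ω) (Real.exp_le_one_iff.2 (by linarith [hc0 ω]))
    · refine (mul_le_of_le_one_right (Real.exp_pos _).le (hF0_le ω)).trans ?_
      exact Real.exp_le_exp.2 (neg_le_neg (abs_le.1 (hc r ⟨hr, r.2⟩ ω)).2)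
  have hpos : ∀ᵐ ω ∂m, 0 < F 0 ω := by
    filter_upwards [hbdd] with ω ⟨C, hC⟩
    exact (Real.exp_pos (-C)).trans_le
      (le_ciInf fun r => Real.exp_le_exp.2 (neg_le_neg (hC r r.2)))
  have hF1_pos : ∀ ω, 0 < F 0 ω → 0 < F 1 ω := fun ω h =>
    (mul_pos (Real.exp_pos _) h).trans_le (hF01 ω)
  set D : Ω → ℝ := fun ω => Real.log (F 0 ω) - Real.log (F 1 ω) with hD
  have hD_meas : Measurable D := (hF_meas 0).log.sub (hF_meas 1).log
  have hD_nonneg : ∀ᵐ ω ∂m, 0 ≤ D ω := by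
    filter_upwards [hpos] with ω hω
    exact sub_nonneg.2 (Real.log_le_log (hF1_pos ω hω) (hF10 ω))
  have hD_le : ∀ᵐ ω ∂m, D ω ≤ c := by
    filter_upwards [hpos] with ω hω
    have := Real.log_le_log (mul_pos (Real.exp_pos (-c)) hω) (hF01 ω)
    rw [Real.log_mul (Real.exp_pos _).ne' hω.ne', Real.log_exp] at this
    simp only [hD]; linarith
  have hD_int : Integrable D m := by
    refine Integrable.of_bound hD_meas.aestronglyMeasurable c ?_
    filter_upwards [hD_nonneg, hD_le] with ω h1 h2
    rwa [Real.norm_of_nonneg h1]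
  have hA1_int : Integrable (A 1) m :=
    Integrable.of_bound (hA 1).measurable.aestronglyMeasurable c
      (Eventually.of_forall fun ω => hc 1 (by simp) ω)
  have hincr : (fun ω => Real.log (F 0 (σ 1 ω)) - Real.log (F 0 ω)) =ᵐ[m]
      fun ω => A 1 ω - D ω := by
    filter_upwards [hpos] with ω hω
    rw [hF_shift, zero_add, Real.log_mul (hF1_pos ω hω).ne' (Real.exp_pos _).ne', Real.log_exp]
    simp only [hD]; ring
  have hD_zero : ∫ ω, D ω ∂m = 0 := by
    have h := integral_comp_sub_eq_zero (hpres 1) (hF_meas 0).log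
      ((hA1_int.sub hD_int).congr hincr.symm)
    rw [integral_congr_ae hincr, integral_sub hA1_int hD_int, hmean] at h
    linarith
  have hF_eq : ∀ᵐ ω ∂m, F 1 ω = F 0 ω := by
    have h0 := (integral_eq_zero_iff_of_nonneg_ae hD_nonneg hD_int).1 hD_zero
    filter_upwards [h0, hpos] with ω hω hp
    exact Real.log_injOn_pos (hF1_pos ω hp) hp (sub_eq_zero.1 hω).symm
  have hF_all : ∀ᵐ ω ∂m, ∀ k : ℕ, F 1 (σ k ω) = F 0 (σ k ω) :=
    ae_all_iff.2 fun k => (hpres k).quasiMeasurePreserving.ae hF_eq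
  filter_upwards [hF_all, hpos] with ω hω hp
  have hconst : ∀ k : ℕ, F k ω = F 0 ω := by
    intro k
    induction k with
    | zero => simp
    | succ k ih =>
      have h := hω k
      rw [hF_shift, hF_shift, zero_add] at h
      rw [← ih, ← mul_right_cancel₀ (Real.exp_pos _).ne' h]
      push_cast
      rw [add_comm]
  refine ⟨-Real.log (F 0 ω), fun t => ?_⟩
  obtain ⟨k, hk⟩ := exists_nat_ge t
  have h := Real.log_le_log hp (hconst k ▸ hF_le k ω t hk)
  rw [Real.log_exp] at h
  linarith

/-- Properties of the function `H_a(ω) = inf_{t∈ℝ} exp(−∫_0^t a(ω·s) ds)`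
when `a ∈ R_m(Ω)`: it is upper semicontinuous with values in `[0,1]`, positive exactly on
the `σ`-invariant full-measure set `Ω^a`, satisfies the cocycle identity, and has zero
infimum along both half-orbits of every point. -/
theorem stmt7 {Ω : Type*} [MetricSpace Ω] [CompactSpace Ω] [Nonempty Ω]
    [MeasurableSpace Ω] [BorelSpace Ω]
    (σ : ℝ → Ω → Ω)
    (hσcont : Continuous fun p : ℝ × Ω => σ p.1 p.2)
    (hσ0 : ∀ ω, σ 0 ω = ω)
    (hσadd : ∀ s t ω, σ (s + t) ω = σ s (σ t ω))
    (hmin : ∀ ω : Ω, Dense (Set.range fun t => σ t ω))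
    (m : Measure Ω) [IsProbabilityMeasure m]
    (hminv : ∀ t, Measure.map (σ t) m = m)
    (herg : ∀ B : Set Ω, MeasurableSet B → (∀ t, σ t ⁻¹' B = B) → m B = 0 ∨ m B = 1)
    (a : Ω → ℝ) (ha : Continuous a)
    (hint : ∫ ω, a ω ∂m = 0)
    (hnoprim : ¬ ∃ h : Ω → ℝ, Continuous h ∧
      ∀ ω t, h (σ t ω) - h ω = ∫ s in (0:ℝ)..t, a (σ s ω))
    (hbdd : ∀ᵐ ω ∂m, ∃ C : ℝ, ∀ t ≤ (0:ℝ), (∫ s in (0:ℝ)..t, a (σ s ω)) ≤ C)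
    (Ha : Ω → ℝ)
    (hHa : ∀ ω, Ha ω = ⨅ t : ℝ, Real.exp (-(∫ s in (0:ℝ)..t, a (σ s ω)))) :
    UpperSemicontinuous Ha ∧
    (∀ ω, Ha ω ∈ Set.Icc (0:ℝ) 1) ∧
    (∀ ω, 0 < Ha ω ↔ ∃ C : ℝ, ∀ t : ℝ, (∫ s in (0:ℝ)..t, a (σ s ω)) ≤ C) ∧
    (∀ ω, 0 < Ha ω → ∀ t : ℝ, 0 < Ha (σ t ω)) ∧
    m {ω : Ω | 0 < Ha ω} = 1 ∧
    (∀ ω t, Ha (σ t ω) = Ha ω * Real.exp (∫ s in (0:ℝ)..t, a (σ s ω))) ∧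
    (∀ ω, ⨅ t : {t : ℝ // t ≤ 0}, Ha (σ t.1 ω) = 0) ∧
    (∀ ω, ⨅ t : {t : ℝ // 0 ≤ t}, Ha (σ t.1 ω) = 0) := by
  have hσt : ∀ t, Continuous (σ t) := fun t => hσcont.comp (Continuous.prodMk_right t)
  have hω : ∀ ω, Continuous fun s => a (σ s ω) := fun ω => ha.comp (hσcont.comp (Continuous.prodMk_left ω))
  set A : ℝ → Ω → ℝ := fun t ω => ∫ s in (0:ℝ)..t, a (σ s ω) with hA
  change ∀ ω, Ha ω = ⨅ t : ℝ, Real.exp (-A t ω) at hHa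
  have hAc : ∀ t, Continuous (A t) := fun t =>
    intervalIntegral.continuous_parametric_intervalIntegral_of_continuous'
      (f := fun ω s => a (σ s ω)) (ha.comp (hσcont.comp continuous_swap)) 0 t
  have hadd : ∀ s t ω, A (s + t) ω = A s (σ t ω) + A t ω := by
    intro s t ω
    simp only [hA, ← hσadd]
    rw [intervalIntegral.integral_comp_add_right (fun r => a (σ r ω)), zero_add,
      add_comm s t, add_comm (intervalIntegral _ _ _ _), intervalIntegral.integral_add_adjacent_intervals] <;>
      exact (hω ω).intervalIntegrable _ _
  have hA0 : ∀ ω, A 0 ω = 0 := fun ω => by simp [hA]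
  obtain ⟨c, hc⟩ : ∃ c, ∀ ω, |a ω| ≤ c := by
    obtain ⟨c, hc⟩ := (isCompact_range ha).isBounded.exists_norm_le
    exact ⟨c, fun ω => hc _ ⟨ω, rfl⟩⟩
  have hc0 : 0 ≤ c := (abs_nonneg _).trans (hc (Classical.arbitrary Ω))
  have hAbd : ∀ t ∈ Set.Icc (0 : ℝ) 1, ∀ ω, |A t ω| ≤ c := by
    intro t ht ω
    have h := intervalIntegral.norm_integral_le_of_norm_le_const (a := 0) (b := t)
      (f := fun s => a (σ s ω)) (C := c) fun s _ => hc _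
    rw [sub_zero, abs_of_nonneg ht.1] at h
    exact h.trans (mul_le_of_le_one_right hc0 ht.2)
  have hpres : ∀ t, MeasurePreserving (σ t) m m := fun t => ⟨(hσt t).measurable, hminv t⟩
  have hmean : ∫ ω, A 1 ω ∂m = 0 := by
    simp only [hA]
    rw [← intervalIntegral_integral_swap (f := fun s ω => a (σ s ω))]
    · have : ∀ s, ∫ ω, a (σ s ω) ∂m = 0 := fun s => by
        have h := integral_map (μ := m) (hpres s).aemeasurable ha.aestronglyMeasurable
        rw [hminv, hint] at h
        exact h.symm
      simp [this]
    · have : IsFiniteMeasure (volume.restrict (Set.uIoc (0 : ℝ) 1)) :=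
        ⟨by simp [Set.uIoc_of_le]⟩
      exact Integrable.of_bound (ha.comp hσcont).aestronglyMeasurable c
        (Eventually.of_forall fun p => hc _)
  have hbelow : ∀ ω, BddBelow (Set.range fun t => Real.exp (-A t ω)) := fun ω =>
    ⟨0, by rintro _ ⟨r, rfl⟩; exact (Real.exp_pos _).le⟩
  have hH_le : ∀ ω t, Ha ω ≤ Real.exp (-A t ω) := fun ω t => hHa ω ▸ ciInf_le (hbelow ω) t
  have hH_nonneg : ∀ ω, 0 ≤ Ha ω := fun ω =>
    hHa ω ▸ Real.iInf_nonneg fun t => (Real.exp_pos _).le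
  have hH_usc : UpperSemicontinuous Ha := by
    rw [funext hHa]
    exact upperSemicontinuous_ciInf hbelow fun t =>
      (Real.continuous_exp.comp (hAc t).neg).upperSemicontinuous
  have hH_iff : ∀ ω, 0 < Ha ω ↔ ∃ C : ℝ, ∀ t : ℝ, A t ω ≤ C := by
    refine fun ω => ⟨fun h => ⟨-Real.log (Ha ω), fun t => ?_⟩, fun ⟨C, hC⟩ => ?_⟩
    · have := Real.log_le_log h (hH_le ω t)
      rw [Real.log_exp] at this
      linarith
    · rw [hHa]
      exact (Real.exp_pos (-C)).trans_le
        (le_ciInf fun t => Real.exp_le_exp.2 (neg_le_neg (hC t)))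
  have hH_shift : ∀ ω t, Ha (σ t ω) = Ha ω * Real.exp (A t ω) := by
    intro ω t
    rw [hHa, hHa, Real.iInf_mul_of_nonneg (Real.exp_pos _).le]
    refine Equiv.iInf_congr (Equiv.addRight t) fun s => ?_
    rw [← Real.exp_add, Equiv.coe_addRight, hadd]
    congr 1; ring
  have hnot : ∀ δ > 0, ¬ ∀ ω, δ ≤ Ha ω := by
    intro δ hδ hle
    have hup : ∀ t ω, A t ω ≤ -Real.log δ := fun t ω => by
      have := Real.log_le_log hδ ((hle ω).trans (hH_le ω t))
      rw [Real.log_exp] at this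
      linarith
    refine hnoprim (exists_continuous_primitive_of_bounded hmin hAc hadd
      (C := -Real.log δ) fun t ω => abs_le.2 ⟨?_, hup t ω⟩)
    have h1 := hadd (-t) t ω
    rw [neg_add_cancel, hA0] at h1
    linarith [hup (-t) (σ t ω)]
  have hhalf : ∀ (l : Filter ℝ) [l.NeBot], (∀ s : ℝ, Tendsto (fun t => s + t) l l) →
      ∀ S : Set ℝ, S.Nonempty → S ∈ l → ∀ ω, ⨅ t : S, Ha (σ t.1 ω) = 0 := by
    intro l _ hl S hS hSl ω
    have : Nonempty S := hS.to_subtype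
    refine le_antisymm (not_lt.1 fun hpos => ?_) (Real.iInf_nonneg fun t => hH_nonneg _)
    refine hnot _ hpos fun x => ?_
    have huniv := eq_univ_of_isClosed_of_eventually_mem hσt hσadd hmin hl
      (hH_usc.isClosed_preimage (⨅ t : S, Ha (σ t.1 ω))) (ω := ω) (by
        filter_upwards [hSl] with t ht
        exact ciInf_le (f := fun t : S => Ha (σ t.1 ω))
          ⟨0, by rintro _ ⟨r, rfl⟩; exact hH_nonneg _⟩ ⟨t, ht⟩)
    exact (huniv ▸ Set.mem_univ x : x ∈ Ha ⁻¹' Set.Ici _)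
  refine ⟨hH_usc, fun ω => ⟨hH_nonneg ω, by simpa [hA0] using hH_le ω 0⟩, hH_iff,
    fun ω h t => hH_shift ω t ▸ mul_pos h (Real.exp_pos _), ?_, hH_shift,
    fun ω => hhalf atBot (fun s => tendsto_atBot_add_const_left _ s tendsto_id) (Set.Iic 0)
      ⟨0, by simp⟩ (Iic_mem_atBot 0) ω,
    fun ω => hhalf atTop (fun s => tendsto_atTop_add_const_left _ s tendsto_id) (Set.Ici 0)
      ⟨0, by simp⟩ (Ici_mem_atTop 0) ω⟩
  rw [← mem_ae_iff_prob_eq_one (measurableSet_lt measurable_const hH_usc.measurable)]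
  filter_upwards [ae_bddAbove_of_ae_bddAbove_nonpos hσ0 hpres hAc hadd hAbd hmean hbdd]
    with ω h
  exact (hH_iff ω).2 h
end

section
/- Let σ be a minimal continuous flow on a nonempty compact metric space Ω, let a : Ω → ℝ be continuous, and let H : Ω → [0,∞) be a bounded upper semicontinuous function satisfying H(ω·t) = H(ω)·exp(∫_0^t a(ω·s) ds) for all ω ∈ Ω and t ∈ ℝ, and inf_{t ≤ 0} H(ω·t) = 0 for every ω ∈ Ω. Then H(ω₀) = 0 at every point ω₀ ∈ Ω at which H is continuous. -/
open MeasureTheory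

/-- If `H : Ω → [0,∞)` is bounded, upper semicontinuous, satisfies the cocycle
identity `H(ω·t) = H(ω)·exp(∫_0^t a(ω·s) ds)`, and `inf_{t ≤ 0} H(ω·t) = 0` for every `ω`,
for a minimal continuous flow on a nonempty compact metric space, then `H` vanishes at every
continuity point. -/
theorem stmt8 {Ω : Type*} [MetricSpace Ω] [CompactSpace Ω] [Nonempty Ω]
    (σ : ℝ → Ω → Ω)
    (hσcont : Continuous fun p : ℝ × Ω => σ p.1 p.2)
    (hσ0 : ∀ ω, σ 0 ω = ω)
    (hσadd : ∀ s t ω, σ (s + t) ω = σ s (σ t ω))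
    (hmin : ∀ ω : Ω, Dense (Set.range fun t => σ t ω))
    (a : Ω → ℝ) (ha : Continuous a)
    (H : Ω → ℝ)
    (hHnonneg : ∀ ω, 0 ≤ H ω)
    (hHbdd : ∃ C : ℝ, ∀ ω, H ω ≤ C)
    (hHusc : UpperSemicontinuous H)
    (hcocycle : ∀ ω t, H (σ t ω) = H ω * Real.exp (∫ s in (0:ℝ)..t, a (σ s ω)))
    (hinf : ∀ ω, ⨅ t : {t : ℝ // t ≤ 0}, H (σ t.1 ω) = 0) :
    ∀ ω₀ : Ω, ContinuousAt H ω₀ → H ω₀ = 0 := by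
  intro ω₀ hω₀
  by_contra hne
  have hpos : 0 < H ω₀ := lt_of_le_of_ne (hHnonneg ω₀) (Ne.symm hne)
  have hev : ∀ᶠ ω in nhds ω₀, H ω₀ / 2 < H ω :=
    hω₀.eventually (lt_mem_nhds (half_lt_self hpos))
  obtain ⟨U, hU, hUo, hω₀U⟩ := eventually_nhds_iff.1 hev
  obtain ⟨M, hM⟩ := isCompact_univ.exists_bound_of_continuousOn ha.continuousOn
  have hbound : ∃ δ > 0, ∀ ω ∈ (Set.univ : Set Ω), δ ≤ H ω := by
    refine isCompact_univ.induction_on (p := fun s => ∃ δ > 0, ∀ ω ∈ s, δ ≤ H ω)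
      ⟨1, one_pos, by simp⟩ ?_ ?_ ?_
    · rintro s t hst ⟨δ, hδ, h⟩
      exact ⟨δ, hδ, fun ω hω => h ω (hst hω)⟩
    · rintro s t ⟨δ, hδ, h⟩ ⟨ε, hε, k⟩
      refine ⟨min δ ε, lt_min hδ hε, ?_⟩
      rintro ω (hω | hω)
      · exact (min_le_left _ _).trans (h ω hω)
      · exact (min_le_right _ _).trans (k ω hω)
    · intro ω _
      obtain ⟨_, htU, t, rfl⟩ := (hmin ω).inter_open_nonempty U hUo ⟨ω₀, hω₀U⟩
      have hσt : Continuous (σ t) := hσcont.comp (Continuous.prodMk_right t)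
      refine ⟨σ t ⁻¹' U, mem_nhdsWithin_of_mem_nhds ((hUo.preimage hσt).mem_nhds htU),
        H ω₀ / 2 * Real.exp (-(M * |t|)), by positivity, fun x hx => ?_⟩
      have hint : ∫ s in (0:ℝ)..t, a (σ s x) ≤ M * |t| := by
        have h := intervalIntegral.norm_integral_le_of_norm_le_const
          (f := fun s => a (σ s x)) (a := 0) (b := t) (C := M) fun s _ => hM _ (Set.mem_univ _)
        rw [sub_zero] at h
        exact (le_abs_self _).trans h
      have hlow : H ω₀ / 2 ≤ H x * Real.exp (M * |t|) :=
        calc H ω₀ / 2 ≤ H (σ t x) := (hU _ hx).le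
          _ = H x * Real.exp (∫ s in (0:ℝ)..t, a (σ s x)) := hcocycle x t
          _ ≤ H x * Real.exp (M * |t|) :=
            mul_le_mul_of_nonneg_left (Real.exp_le_exp.2 hint) (hHnonneg x)
      rwa [Real.exp_neg, ← div_eq_mul_inv, div_le_iff₀ (Real.exp_pos _)]
  obtain ⟨δ, hδ, h⟩ := hbound
  have : Nonempty {t : ℝ // t ≤ 0} := ⟨⟨0, le_rfl⟩⟩
  have hle : δ ≤ ⨅ t : {t : ℝ // t ≤ 0}, H (σ t.1 ω₀) :=
    le_ciInf fun t => h _ (Set.mem_univ _)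
  rw [hinf ω₀] at hle
  exact absurd hle (not_le.2 hδ)
end

section
/- Let σ be a minimal continuous flow on a nonempty compact metric space Ω, let m be a σ-ergodic Borel probability measure on Ω, and let a ∈ R_m(Ω). Define H_a(ω) := inf_{t ∈ ℝ} exp(−∫_0^t a(ω·s) ds) and Ω^a := { ω ∈ Ω : H_a(ω) > 0 }. Then for every ε ∈ (0,1) there exists a subset Ω_ε ⊆ Ω^a with m(Ω_ε) = 1 such that for every ω ∈ Ω_ε the set I_ε(ω) := { t ≥ 0 : H_a(ω·t) ≤ ε·H_a(ω) } has positive lower density (liminf_{t→∞} (1/t)·Leb([0,t] ∩ I_ε(ω)) > 0) and is relatively dense in [0,∞) (there exists L > 0 such that I_ε(ω) meets every subinterval of [0,∞) of length L). -/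
open MeasureTheory Filter

/-- Nonnegative limits of centred functions with a common lower bound vanish almost everywhere. -/
lemma ae_eq_zero_of_tendsto_of_integral_eq_zero {α : Type*} [MeasurableSpace α] {μ : Measure α}
    [IsProbabilityMeasure μ] {f : ℕ → α → ℝ} {d : α → ℝ} {C : ℝ}
    (hf : ∀ k, Integrable (f k) μ) (hf0 : ∀ k, ∫ x, f k x ∂μ = 0) (hfC : ∀ k x, -C ≤ f k x)
    (hlim : ∀ᵐ x ∂μ, Tendsto (fun k => f k x) atTop (nhds (d x)))
    (hd : ∀ᵐ x ∂μ, 0 ≤ d x) : ∀ᵐ x ∂μ, d x = 0 := by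
  have hdm : AEMeasurable d μ :=
    aemeasurable_of_tendsto_metrizable_ae atTop (fun k => (hf k).aemeasurable) hlim
  have hk : ∀ k, ∫⁻ x, ENNReal.ofReal (f k x + C) ∂μ = ENNReal.ofReal C := by
    intro k
    rw [← ofReal_integral_eq_lintegral_ofReal
      (show Integrable (fun x => f k x + C) μ from (hf k).add (integrable_const C))
      (ae_of_all _ fun x => by simpa using neg_le_iff_add_nonneg.1 (hfC k x)),
      integral_add (hf k) (integrable_const C), hf0 k]
    simp
  have hfatou : ∫⁻ x, ENNReal.ofReal (d x + C) ∂μ ≤ ENNReal.ofReal C := by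
    calc ∫⁻ x, ENNReal.ofReal (d x + C) ∂μ
        = ∫⁻ x, liminf (fun k => ENNReal.ofReal (f k x + C)) atTop ∂μ := by
          refine lintegral_congr_ae (hlim.mono fun x hx => ?_)
          exact ((ENNReal.continuous_ofReal.tendsto _).comp
            (hx.add_const C)).liminf_eq.symm
      _ ≤ liminf (fun k => ∫⁻ x, ENNReal.ofReal (f k x + C) ∂μ) atTop :=
          lintegral_liminf_le' fun k => ((hf k).aemeasurable.add_const C).ennreal_ofReal
      _ = ENNReal.ofReal C := by simp [hk]
  have hC : 0 ≤ C := by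
    have := integral_mono (integrable_const (-C)) (hf 0) (hfC 0)
    rw [hf0 0] at this
    simpa using this
  have hdC : ∀ᵐ x ∂μ, 0 ≤ d x + C := hd.mono fun x hx => by linarith
  have hint : Integrable (fun x => d x + C) μ :=
    ⟨(hdm.add_const C).aestronglyMeasurable, by
      rw [hasFiniteIntegral_iff_ofReal hdC]
      exact hfatou.trans_lt ENNReal.ofReal_lt_top⟩
  have hdi : Integrable d μ :=
    (hint.sub (integrable_const C)).congr (ae_of_all _ fun x => by simp)
  have hle : ∫ x, (d x + C) ∂μ ≤ C := by
    rw [integral_eq_lintegral_of_nonneg_ae hdC hint.aestronglyMeasurable]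
    exact ENNReal.toReal_le_of_le_ofReal hC hfatou
  rw [integral_add hdi (integrable_const C)] at hle
  have h0 : ∫ x, d x ∂μ = 0 :=
    le_antisymm (by simpa using hle) (integral_nonneg_of_ae hd)
  exact (integral_eq_zero_iff_of_nonneg_ae hd hdi).1 h0

/-- A subset of the line containing an interval of length `τ` in each interval `[s, s + L]`, `s ≥ 0`,
has positive lower density. -/
lemma liminf_volume_div_pos {I : Set ℝ} {τ L : ℝ} (hτ : 0 < τ) (hL : 0 < L)
    (hI : ∀ s ≥ (0:ℝ), ∃ t, s ≤ t ∧ t + τ ≤ s + L ∧ Set.Icc t (t + τ) ⊆ I) :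
    0 < liminf (fun T : ℝ => (volume (Set.Icc (0:ℝ) T ∩ I)).toReal / T) atTop := by
  have hn : ∀ n : ℕ, ENNReal.ofReal (n * τ) ≤ volume (Set.Icc (0:ℝ) (n * L) ∩ I) := by
    intro n
    induction n with
    | zero => simp
    | succ n ih =>
      obtain ⟨t, ht1, ht2, ht3⟩ := hI (n * L) (by positivity)
      have hnL : 0 ≤ n * L := by positivity
      rw [← measure_inter_add_sdiff _ (measurableSet_Iic (a := (n * L : ℝ)))]
      have h1 : volume (Set.Icc (0:ℝ) (n * L) ∩ I) ≤
          volume (Set.Icc (0:ℝ) ((n + 1 : ℕ) * L) ∩ I ∩ Set.Iic (n * L)) := by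
        refine measure_mono fun x hx => ⟨⟨⟨hx.1.1, ?_⟩, hx.2⟩, hx.1.2⟩
        push_cast
        linarith [hx.1.2]
      have h2 : ENNReal.ofReal τ ≤
          volume ((Set.Icc (0:ℝ) ((n + 1 : ℕ) * L) ∩ I) \ Set.Iic (n * L)) := by
        calc ENNReal.ofReal τ = volume (Set.Ioc t (t + τ)) := by simp
          _ ≤ _ := by
            refine measure_mono fun x hx => ⟨⟨⟨?_, ?_⟩, ht3 ⟨hx.1.le, hx.2⟩⟩, ?_⟩
            · linarith [hx.1]
            · push_cast
              linarith [hx.2]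
            · simpa using lt_of_le_of_lt ht1 hx.1
      calc ENNReal.ofReal ((n + 1 : ℕ) * τ)
          = ENNReal.ofReal (n * τ) + ENNReal.ofReal τ := by
            rw [← ENNReal.ofReal_add (by positivity) hτ.le]
            push_cast
            ring_nf
        _ ≤ _ := add_le_add (ih.trans h1) h2
  have hfin : ∀ T : ℝ, volume (Set.Icc (0:ℝ) T ∩ I) ≠ ⊤ := fun T =>
    ((measure_mono Set.inter_subset_left).trans_lt measure_Icc_lt_top).ne
  have hlow : ∀ᶠ T : ℝ in atTop,
      τ / (2 * L) ≤ (volume (Set.Icc (0:ℝ) T ∩ I)).toReal / T := by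
    filter_upwards [eventually_ge_atTop (2 * L)] with T hT
    have hT0 : 0 < T := by linarith
    have hfloor : (⌊T / L⌋₊ : ℝ) * L ≤ T :=
      (le_div_iff₀ hL).1 (Nat.floor_le (by positivity))
    have hfloor2 : T < (⌊T / L⌋₊ + 1 : ℝ) * L :=
      (div_lt_iff₀ hL).1 (Nat.lt_floor_add_one _)
    have h1 : (⌊T / L⌋₊ : ℝ) * τ ≤ (volume (Set.Icc (0:ℝ) T ∩ I)).toReal := by
      refine (ENNReal.ofReal_le_iff_le_toReal (hfin T)).1 ((hn _).trans (measure_mono ?_))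
      exact Set.inter_subset_inter_left _ (Set.Icc_subset_Icc_right hfloor)
    rw [div_le_div_iff₀ (by positivity) hT0]
    nlinarith
  have hupp : ∀ᶠ T : ℝ in atTop, (volume (Set.Icc (0:ℝ) T ∩ I)).toReal / T ≤ 1 := by
    filter_upwards [eventually_gt_atTop 0] with T hT
    rw [div_le_one hT]
    have := ENNReal.toReal_mono measure_Icc_lt_top.ne
      (measure_mono (μ := volume) (Set.inter_subset_left (s := Set.Icc (0:ℝ) T) (t := I)))
    simpa [hT.le] using this
  exact lt_of_lt_of_le (by positivity)
    (le_liminf_of_le (isBoundedUnder_of_eventually_le hupp).isCoboundedUnder_ge hlow)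

/-- In a minimal flow on a compact space, the visit times to a nonempty open set are uniformly
relatively dense. -/
lemma exists_uniform_visit_time {Ω : Type*} [TopologicalSpace Ω] [CompactSpace Ω] {σ : ℝ → Ω → Ω}
    (hσt : ∀ t, Continuous (σ t)) (hσadd : ∀ s t ω, σ (s + t) ω = σ s (σ t ω))
    (hmin : ∀ ω : Ω, Dense (Set.range fun t => σ t ω))
    {V : Set Ω} (hV : IsOpen V) (hne : V.Nonempty) :
    ∃ K > (0:ℝ), ∀ ω s, ∃ t, s ≤ t ∧ t ≤ s + K ∧ σ t ω ∈ V := by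
  obtain ⟨F, hF⟩ := isCompact_univ.elim_finite_subcover (fun t => σ t ⁻¹' V)
    (fun t => hV.preimage (hσt t)) (fun ω _ => by
      obtain ⟨_, hx, t, rfl⟩ := (hmin ω).inter_open_nonempty V hV hne
      exact Set.mem_iUnion.2 ⟨t, hx⟩)
  obtain ⟨M, hM⟩ := F.finite_toSet.isBounded.exists_norm_le
  refine ⟨2 * |M| + 1, by positivity, fun ω s => ?_⟩
  obtain ⟨t, ht, htV⟩ := Set.mem_iUnion₂.1 (hF (Set.mem_univ (σ (s + |M|) ω)))
  have h1 : |t| ≤ |M| := (hM t ht).trans (le_abs_self M)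
  rw [abs_le] at h1
  refine ⟨t + (s + |M|), by linarith, by linarith, ?_⟩
  rw [hσadd]
  exact htV

/-- A cocycle over a minimal flow which is uniformly bounded above is a coboundary. -/
lemma exists_continuous_primitive {Ω : Type*} [TopologicalSpace Ω] {σ : ℝ → Ω → Ω}
    (hmin : ∀ ω : Ω, Dense (Set.range fun t => σ t ω))
    {S : ℝ → Ω → ℝ} (hS : ∀ t, Continuous (S t)) (hS0 : ∀ ω, S 0 ω = 0)
    (hSadd : ∀ s t ω, S (s + t) ω = S t ω + S s (σ t ω))
    {C : ℝ} (hC : ∀ t ω, S t ω ≤ C) :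
    ∃ h : Ω → ℝ, Continuous h ∧ ∀ ω t, h (σ t ω) - h ω = S t ω := by
  have hC' : ∀ t ω, -C ≤ S t ω := by
    intro t ω
    have h1 := hSadd (-t) t ω
    have h2 := hC (-t) (σ t ω)
    rw [neg_add_cancel, hS0] at h1
    linarith
  have hba : ∀ ω, BddAbove (Set.range fun t => S t ω) := fun ω =>
    ⟨C, by rintro _ ⟨t, rfl⟩; exact hC t ω⟩
  have hbb : ∀ ω, BddBelow (Set.range fun t => S t ω) := fun ω =>
    ⟨-C, by rintro _ ⟨t, rfl⟩; exact hC' t ω⟩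
  have hshift : ∀ s t ω, S s (σ t ω) = S (s + t) ω + -S t ω := fun s t ω => by
    rw [hSadd]; ring
  have hsup : ∀ t ω, (⨆ s, S s (σ t ω)) = (⨆ s, S s ω) - S t ω := by
    intro t ω
    simp_rw [hshift]
    rw [sub_eq_add_neg, ciSup_add (hba ω)]
    exact (Equiv.addRight t).iSup_comp (g := fun s => S s ω + -S t ω)
  have hinf : ∀ t ω, (⨅ s, S s (σ t ω)) = (⨅ s, S s ω) - S t ω := by
    intro t ω
    simp_rw [hshift]
    rw [sub_eq_add_neg, ciInf_add (hbb ω)]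
    exact (Equiv.addRight t).iInf_comp (g := fun s => S s ω + -S t ω)
  have hlsc : LowerSemicontinuous fun ω => ⨆ s, S s ω :=
    lowerSemicontinuous_ciSup hba fun s => (hS s).lowerSemicontinuous
  have husc : UpperSemicontinuous fun ω => ⨅ s, S s ω :=
    upperSemicontinuous_ciInf hbb fun s => (hS s).upperSemicontinuous
  have hD : LowerSemicontinuous fun ω => (⨆ s, S s ω) + -(⨅ s, S s ω) :=
    hlsc.add husc.neg
  have hconst : ∀ x y, (⨆ s, S s y) + -(⨅ s, S s y) ≤ (⨆ s, S s x) + -(⨅ s, S s x) := by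
    intro x y
    have hcl := hD.isClosed_preimage ((⨆ s, S s x) + -(⨅ s, S s x))
    have hsub : Set.range (fun t => σ t x) ⊆
        (fun ω => (⨆ s, S s ω) + -(⨅ s, S s ω)) ⁻¹' Set.Iic ((⨆ s, S s x) + -(⨅ s, S s x)) := by
      rintro _ ⟨t, rfl⟩
      simp only [Set.mem_preimage, Set.mem_Iic, hsup, hinf]
      linarith
    exact hcl.closure_subset_iff.2 hsub (hmin x y)
  rcases isEmpty_or_nonempty Ω with hΩ | ⟨⟨x⟩⟩
  · exact ⟨fun _ => 0, continuous_const, fun ω => hΩ.elim ω⟩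
  have husc' : UpperSemicontinuous fun ω => ⨆ s, S s ω := by
    have : (fun ω => ⨆ s, S s ω) =
        fun ω => (⨅ s, S s ω) + ((⨆ s, S s x) + -(⨅ s, S s x)) := by
      funext ω
      linarith [hconst x ω, hconst ω x]
    rw [this]
    exact husc.add upperSemicontinuous_const
  refine ⟨fun ω => -⨆ s, S s ω,
    (continuous_iff_lower_upperSemicontinuous.2 ⟨hlsc, husc'⟩).neg, fun ω t => ?_⟩
  simp only [hsup]
  ring

/-- A centred cocycle which is almost everywhere bounded above on the negative half-line is almost
everywhere bounded above. -/
lemma ae_bddAbove_of_ae_bddAbove_Iic {Ω : Type*} [TopologicalSpace Ω] [CompactSpace Ω]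
    [MeasurableSpace Ω] [BorelSpace Ω] {σ : ℝ → Ω → Ω}
    {m : Measure Ω} [IsProbabilityMeasure m] (hσ : ∀ t, MeasurePreserving (σ t) m m)
    {S : ℝ → Ω → ℝ} (hS : ∀ t, Continuous (S t)) (hS0 : ∀ ω, S 0 ω = 0)
    (hSadd : ∀ s t ω, S (s + t) ω = S t ω + S s (σ t ω))
    (hint : ∀ t, ∫ ω, S t ω ∂m = 0)
    (hbdd : ∀ᵐ ω ∂m, ∃ C : ℝ, ∀ t ≤ (0:ℝ), S t ω ≤ C) :
    ∀ᵐ ω ∂m, ∃ C : ℝ, ∀ t, S t ω ≤ C := by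
  set b : Ω → ℝ := fun ω => ⨆ t : Set.Iic (0:ℝ), S t ω with hb
  set B : ℕ → Ω → ℝ := fun k ω => ⨆ t : Set.Iic (0:ℝ), min (S t ω) k with hB
  have hBbdd : ∀ (k : ℕ) ω, BddAbove (Set.range fun t : Set.Iic (0:ℝ) => min (S t ω) k) :=
    fun k ω => ⟨k, by rintro _ ⟨t, rfl⟩; exact min_le_right _ _⟩
  have hBle : ∀ k ω, B k ω ≤ k := fun k ω => ciSup_le fun t => min_le_right _ _
  have hBge : ∀ k ω, 0 ≤ B k ω := fun k ω =>
    le_ciSup_of_le (hBbdd k ω) ⟨0, Set.self_mem_Iic⟩ (by simp [hS0])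
  have hBmeas : ∀ k, Measurable (B k) := fun k =>
    (lowerSemicontinuous_ciSup (hBbdd k) fun t =>
      ((hS t).min continuous_const).lowerSemicontinuous).measurable
  have hBint : ∀ k, Integrable (B k) m := fun k =>
    Integrable.of_bound (hBmeas k).aestronglyMeasurable k (ae_of_all _ fun ω => by
      rw [Real.norm_of_nonneg (hBge k ω)]; exact hBle k ω)
  have hSint : ∀ t, Integrable (S t) m := fun t =>
    (hS t).integrable_of_hasCompactSupport (HasCompactSupport.of_compactSpace _)
  have hBlim : ∀ ω, (∃ C : ℝ, ∀ t ≤ (0:ℝ), S t ω ≤ C) →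
      Tendsto (fun k => B k ω) atTop (nhds (b ω)) := by
    rintro ω ⟨C, hC⟩
    obtain ⟨N, hN⟩ := exists_nat_ge C
    refine tendsto_const_nhds.congr' ?_
    filter_upwards [eventually_ge_atTop N] with k hk
    refine iSup_congr fun t => (min_eq_left ((hC t t.2).trans (hN.trans ?_))).symm
    exact_mod_cast hk
  have key : ∀ n : ℕ, ∀ᵐ ω ∂m, ∀ t ≤ (n:ℝ), S t ω ≤ b ω := by
    intro n
    have hn : (0:ℝ) ≤ n := n.cast_nonneg
    obtain ⟨C, hC⟩ : ∃ C, ∀ ω, |S n ω| ≤ C := by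
      obtain ⟨C, hC⟩ := isCompact_univ.exists_bound_of_continuousOn (hS n).continuousOn
      exact ⟨C, fun ω => hC ω trivial⟩
    have hshift : ∀ t ω, S t ω = S n ω + S (t - n) (σ n ω) := fun t ω => by
      rw [← hSadd, sub_add_cancel]
    have hbad := (hσ n).quasiMeasurePreserving.ae hbdd
    have hzero := ae_eq_zero_of_tendsto_of_integral_eq_zero (μ := m) (C := 2 * C)
      (f := fun k ω => S n ω + (B k (σ n ω) - B k ω))
      (d := fun ω => S n ω + (b (σ n ω) - b ω))
      (fun k => (hSint n).add (((hσ n).integrable_comp_of_integrable (hBint k)).sub (hBint k)))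
      (fun k => by
        have hc : Integrable (fun ω => B k (σ n ω)) m :=
          (hσ n).integrable_comp_of_integrable (hBint k)
        have he : ∫ ω, B k (σ n ω) ∂m = ∫ ω, B k ω ∂m := by
          have := integral_map (μ := m) (hσ n).measurable.aemeasurable
            (hBmeas k).aestronglyMeasurable
          rw [(hσ n).map_eq] at this
          exact this.symm
        have hs : Integrable (fun ω => B k (σ n ω) - B k ω) m := hc.sub (hBint k)
        rw [integral_add (hSint n) hs, integral_sub hc (hBint k), he, hint]
        ring)
      (fun k ω => by
        have h1 := abs_le.1 (hC ω)
        have h2 : B k ω ≤ B k (σ n ω) + C := by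
          refine ciSup_le fun t => ?_
          have h3 : min (S (t - n) (σ n ω)) k ≤ B k (σ n ω) :=
            le_ciSup (hBbdd k (σ n ω)) ⟨t - n, by
              have := t.2
              simp only [Set.mem_Iic] at this ⊢
              linarith⟩
          rw [hshift t ω]
          rcases min_cases (S (t - n) (σ n ω)) (k:ℝ) with h4 | h4
          · exact (min_le_left _ _).trans (by linarith)
          · exact (min_le_right _ _).trans (by linarith [abs_nonneg (S n ω), hC ω])
        linarith)
      (by
        filter_upwards [hbdd, hbad] with ω h1 h2
        exact ((hBlim _ h2).sub (hBlim _ h1)).const_add _)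
      (by
        filter_upwards [hbad] with ω ⟨D, hD⟩
        have : b ω ≤ S n ω + b (σ n ω) := by
          refine ciSup_le fun t => ?_
          have h3 : S (t - n) (σ n ω) ≤ b (σ n ω) :=
            le_ciSup (f := fun t : Set.Iic (0:ℝ) => S t (σ n ω))
              ⟨D, by rintro _ ⟨t, rfl⟩; exact hD t t.2⟩ ⟨t - n, by
              have := t.2
              simp only [Set.mem_Iic] at this ⊢
              linarith⟩
          rw [hshift t ω]
          linarith
        linarith)
    filter_upwards [hzero, hbad] with ω h1 ⟨D, hD⟩ t ht
    have h3 : S (t - n) (σ n ω) ≤ b (σ n ω) :=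
      le_ciSup (f := fun t : Set.Iic (0:ℝ) => S t (σ n ω))
        ⟨D, by rintro _ ⟨t, rfl⟩; exact hD t t.2⟩ ⟨t - n, by
          simp only [Set.mem_Iic]
          linarith⟩
    rw [hshift t ω]
    linarith
  filter_upwards [ae_all_iff.2 key] with ω hω
  refine ⟨b ω, fun t => ?_⟩
  obtain ⟨n, hn⟩ := exists_nat_ge t
  exact hω n t hn

/-- For `a ∈ R_m(Ω)` and `ε ∈ (0,1)`, for `m`-almost every `ω` in
`Ω^a = {H_a > 0}` the set `I_ε(ω) = {t ≥ 0 : H_a(ω·t) ≤ ε H_a(ω)}` has positive lower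
density and is relatively dense in `[0,∞)`. -/
theorem stmt9 {Ω : Type*} [MetricSpace Ω] [CompactSpace Ω] [Nonempty Ω]
    [MeasurableSpace Ω] [BorelSpace Ω]
    (σ : ℝ → Ω → Ω)
    (hσcont : Continuous fun p : ℝ × Ω => σ p.1 p.2)
    (hσ0 : ∀ ω, σ 0 ω = ω)
    (hσadd : ∀ s t ω, σ (s + t) ω = σ s (σ t ω))
    (hmin : ∀ ω : Ω, Dense (Set.range fun t => σ t ω))
    (m : Measure Ω) [IsProbabilityMeasure m]
    (hminv : ∀ t, Measure.map (σ t) m = m)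
    (herg : ∀ B : Set Ω, MeasurableSet B → (∀ t, σ t ⁻¹' B = B) → m B = 0 ∨ m B = 1)
    (a : Ω → ℝ) (ha : Continuous a)
    (hint : ∫ ω, a ω ∂m = 0)
    (hnoprim : ¬ ∃ h : Ω → ℝ, Continuous h ∧
      ∀ ω t, h (σ t ω) - h ω = ∫ s in (0:ℝ)..t, a (σ s ω))
    (hbdd : ∀ᵐ ω ∂m, ∃ C : ℝ, ∀ t ≤ (0:ℝ), (∫ s in (0:ℝ)..t, a (σ s ω)) ≤ C)
    (Ha : Ω → ℝ)
    (hHa : ∀ ω, Ha ω = ⨅ t : ℝ, Real.exp (-(∫ s in (0:ℝ)..t, a (σ s ω))))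
    (ε : ℝ) (hε : ε ∈ Set.Ioo (0:ℝ) 1) :
    ∃ Ωε : Set Ω, Ωε ⊆ {ω : Ω | 0 < Ha ω} ∧ m Ωε = 1 ∧
      ∀ ω ∈ Ωε,
        (0 < Filter.liminf
            (fun T : ℝ =>
              (volume (Set.Icc (0:ℝ) T ∩ {t : ℝ | 0 ≤ t ∧ Ha (σ t ω) ≤ ε * Ha ω})).toReal / T)
            Filter.atTop) ∧
        (∃ L > (0:ℝ), ∀ s ≥ (0:ℝ),
          ∃ t ∈ {t : ℝ | 0 ≤ t ∧ Ha (σ t ω) ≤ ε * Ha ω}, s ≤ t ∧ t ≤ s + L) := by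
  set S : ℝ → Ω → ℝ := fun t ω => ∫ s in (0:ℝ)..t, a (σ s ω) with hSdef
  have hσt : ∀ t, Continuous (σ t) := fun t => hσcont.comp (by fun_prop : Continuous fun ω => (t, ω))
  have hσω : ∀ ω, Continuous fun s => a (σ s ω) := fun ω =>
    ha.comp (hσcont.comp (by fun_prop : Continuous fun s => (s, ω)))
  have hσ : ∀ t, MeasurePreserving (σ t) m m := fun t => ⟨(hσt t).measurable, hminv t⟩
  have hS : ∀ t, Continuous (S t) := fun t =>
    intervalIntegral.continuous_parametric_intervalIntegral_of_continuous'
      (f := fun ω s => a (σ s ω)) (ha.comp (hσcont.comp continuous_swap)) 0 t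
  have hS0 : ∀ ω, S 0 ω = 0 := fun ω => intervalIntegral.integral_same
  have hSadd : ∀ s t ω, S (s + t) ω = S t ω + S s (σ t ω) := by
    intro s t ω
    simp only [hSdef, ← hσadd]
    rw [intervalIntegral.integral_comp_add_right (fun r => a (σ r ω)), zero_add]
    exact (intervalIntegral.integral_add_adjacent_intervals
      ((hσω ω).intervalIntegrable _ _) ((hσω ω).intervalIntegrable _ _)).symm
  have hSint : ∀ t, ∫ ω, S t ω ∂m = 0 := by
    intro t
    have hinv : ∀ s, ∫ ω, a (σ s ω) ∂m = 0 := fun s => by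
      have := integral_map (μ := m) (hσt s).measurable.aemeasurable
        (f := a) ha.measurable.aestronglyMeasurable
      rw [← this, hminv, hint]
    obtain ⟨C, hC⟩ := isCompact_univ.exists_bound_of_continuousOn ha.continuousOn
    have hcont : Continuous fun p : ℝ × Ω => a (σ p.1 p.2) := ha.comp hσcont
    have : IsFiniteMeasure (volume.restrict (Set.uIoc 0 t)) := ⟨by simp [Set.uIoc]⟩
    have hprod : Integrable (Function.uncurry fun s ω => a (σ s ω))
        ((volume.restrict (Set.uIoc 0 t)).prod m) :=
      Integrable.of_bound hcont.measurable.aestronglyMeasurable C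
        (ae_of_all _ fun p => hC _ trivial)
    rw [← intervalIntegral_integral_swap hprod]
    simp [hinv]
  have hbb : ∀ ω, BddBelow (Set.range fun t => Real.exp (-S t ω)) := fun ω =>
    ⟨0, by rintro _ ⟨t, rfl⟩; exact (Real.exp_pos _).le⟩
  have husc : UpperSemicontinuous Ha := by
    rw [funext hHa]
    exact upperSemicontinuous_ciInf hbb fun t =>
      (Real.continuous_exp.comp (hS t).neg).upperSemicontinuous
  have hsmall : ∀ c > 0, ∃ x, Ha x < c := by
    intro c hc
    by_contra! hcon
    refine hnoprim (exists_continuous_primitive hmin hS hS0 hSadd (C := -Real.log c) ?_)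
    intro t ω
    have h1 : c ≤ Real.exp (-S t ω) := by
      refine (hcon ω).trans ?_
      rw [hHa]
      exact ciInf_le (hbb ω) t
    linarith [(Real.log_le_iff_le_exp hc).2 h1]
  have hpos : ∀ᵐ ω ∂m, 0 < Ha ω := by
    filter_upwards [ae_bddAbove_of_ae_bddAbove_Iic hσ hS hS0 hSadd hSint hbdd] with ω ⟨C, hC⟩
    rw [hHa]
    exact (Real.exp_pos (-C)).trans_le
      (le_ciInf fun t => Real.exp_le_exp.2 (neg_le_neg (hC t)))
  refine ⟨{ω | 0 < Ha ω}, subset_rfl, (prob_compl_eq_zero_iff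
    (measurableSet_lt measurable_const husc.measurable)).1 hpos, fun ω hω => ?_⟩
  have hU : IsOpen {x | Ha x < ε * Ha ω} := husc.isOpen_preimage _
  obtain ⟨x₀, hx₀⟩ := hsmall (ε * Ha ω) (mul_pos hε.1 hω)
  obtain ⟨τ, hτ, V, hV, hxV, hVU⟩ : ∃ τ > (0:ℝ), ∃ V : Set Ω, IsOpen V ∧ x₀ ∈ V ∧
      ∀ s, |s| ≤ τ → ∀ x ∈ V, Ha (σ s x) < ε * Ha ω := by
    have hnhds : (fun p : ℝ × Ω => σ p.1 p.2) ⁻¹' {x | Ha x < ε * Ha ω} ∈ nhds ((0:ℝ), x₀) :=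
      (hU.preimage hσcont).mem_nhds (by simpa [hσ0] using hx₀)
    rw [nhds_prod_eq] at hnhds
    obtain ⟨A, hA, V', hV', hAV⟩ := Filter.mem_prod_iff.1 hnhds
    obtain ⟨τ, hτ, hτA⟩ := Metric.nhds_basis_closedBall.mem_iff.1 hA
    obtain ⟨V, hVV', hV, hxV⟩ := mem_nhds_iff.1 hV'
    exact ⟨τ, hτ, V, hV, hxV, fun s hs x hx =>
      hAV (Set.mk_mem_prod (hτA (by simpa using hs)) (hVV' hx))⟩
  obtain ⟨K, hK, hvisit⟩ := exists_uniform_visit_time hσt hσadd hmin hV ⟨x₀, hxV⟩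
  have hI : ∀ s ≥ (0:ℝ), ∃ t, s ≤ t ∧ t + τ ≤ s + (K + τ) ∧
      Set.Icc t (t + τ) ⊆ {t : ℝ | 0 ≤ t ∧ Ha (σ t ω) ≤ ε * Ha ω} := by
    intro s hs
    obtain ⟨t, h1, h2, h3⟩ := hvisit ω s
    refine ⟨t, h1, by linarith, fun r hr => ⟨by linarith [hr.1], ?_⟩⟩
    have := hVU (r - t) (abs_le.2 ⟨by linarith [hr.1], by linarith [hr.2]⟩) _ h3
    rw [← hσadd, sub_add_cancel] at this
    exact this.le
  refine ⟨liminf_volume_div_pos hτ (by positivity) hI, K + τ, by positivity, fun s hs => ?_⟩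
  obtain ⟨t, h1, h2, h3⟩ := hI s hs
  exact ⟨t, h3 ⟨le_rfl, by linarith⟩, h1, by linarith⟩
end
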